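/- arXiv:0808.1038 — 2 statements merged into one kernel-verified Lean document; each statement's English description precedes it below -/
import Mathlib

section
/- Let Y be the space of all places of the algebraic closure of ℚ with its natural totally disconnected, locally compact, Hausdorff topology, let λ be the Galois-invariant regular Borel measure on Y described below, let 𝔛 = {F ∈ L¹(Y, λ) : ∫_Y F dλ = 0}, and let 𝔉 = {f_α : α ∈ Q̄ˣ} where f_α(y) = log‖α‖_y. Then 𝔉 is dense in 𝔛 with respect to the L¹-norm. (Consequently 𝔛 is a co-dimension one closed subspace of L¹(Y, λ) containing 𝔉 as a dense subset.) -/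
open MeasureTheory

section

open NumberField

theorem isUltrametricDist_of_eq_padicNorm {K : Type*} [Field K] [CharZero K]
    {w : AbsoluteValue K ℝ} {p : ℕ} [Fact p.Prime]
    (hw : ∀ q : ℚ, w (algebraMap ℚ K q) = padicNorm p q) : IsUltrametricDist (WithAbs w) := by
  refine IsUltrametricDist.isUltrametricDist_of_forall_norm_natCast_le_one fun n => ?_
  have h : w (n : K) ≤ 1 := by
    have := hw n
    rw [map_natCast] at this
    rw [this]
    exact_mod_cast padicNorm.of_nat n
  exact h

theorem absoluteValue_le_one_of_isIntegral {K : Type*} [Field K] {w : AbsoluteValue K ℝ}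
    [IsUltrametricDist (WithAbs w)] {x : K} (hx : IsIntegral ℤ x) : w x ≤ 1 := by
  have hx' : IsIntegral ℤ (WithAbs.toAbs w x) := map_isIntegral_int (WithAbs.equiv w).symm hx
  have h := (Valuation.integer.integers (NormedField.valuation (K := WithAbs w))).mem_of_integral
    (x := WithAbs.toAbs w x) (by
      obtain ⟨f, hf, hx⟩ := hx'
      refine ⟨f.map (Int.castRingHom _), hf.map _, ?_⟩
      rw [Polynomial.eval₂_map, ← hx]
      congr 1)
  exact h

/-- The prime ideal of algebraic integers of absolute value less than one. -/
def ltOneIdeal {K : Type*} [Field K] (w : AbsoluteValue K ℝ) [IsUltrametricDist (WithAbs w)] :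
    Ideal (𝓞 K) where
  carrier := {x | w x < 1}
  zero_mem' := by simp
  add_mem' {a b} ha hb := by
    have := IsUltrametricDist.norm_add_le_max (WithAbs.toAbs w (a : K)) (WithAbs.toAbs w (b : K))
    exact lt_of_le_of_lt this (max_lt ha hb)
  smul_mem' c x hx := by
    have hc : w c ≤ 1 := absoluteValue_le_one_of_isIntegral c.isIntegral_coe
    change w ((c : K) * x) < 1
    rw [map_mul]
    exact (mul_le_of_le_one_left (w.nonneg _) hc).trans_lt hx

theorem mem_ltOneIdeal {K : Type*} [Field K] {w : AbsoluteValue K ℝ}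
    [IsUltrametricDist (WithAbs w)] {x : 𝓞 K} : x ∈ ltOneIdeal w ↔ w x < 1 := Iff.rfl

theorem notMem_ltOneIdeal {K : Type*} [Field K] {w : AbsoluteValue K ℝ}
    [IsUltrametricDist (WithAbs w)] {x : 𝓞 K} : x ∉ ltOneIdeal w ↔ w x = 1 := by
  rw [mem_ltOneIdeal, not_lt]
  exact ⟨fun h => le_antisymm (absoluteValue_le_one_of_isIntegral x.isIntegral_coe) h, ge_of_eq⟩

instance {K : Type*} [Field K] (w : AbsoluteValue K ℝ) [IsUltrametricDist (WithAbs w)] :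
    (ltOneIdeal w).IsPrime := by
  refine Ideal.isPrime_iff.2 ⟨fun h => ?_, fun {x y} hxy => ?_⟩
  · have : (1 : 𝓞 K) ∈ ltOneIdeal w := h ▸ Submodule.mem_top
    simp [mem_ltOneIdeal] at this
  · by_contra! h
    rw [notMem_ltOneIdeal, notMem_ltOneIdeal] at h
    change w ((x : K) * y) < 1 at hxy
    rw [map_mul, h.1, h.2] at hxy
    norm_num at hxy

/-- Some power of a nonzero ideal of the ring of integers of a number field is principal. -/
theorem exists_pow_eq_span_singleton {K : Type*} [Field K] [NumberField K] {P : Ideal (𝓞 K)}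
    (hP : P ≠ ⊥) : ∃ h : ℕ, h ≠ 0 ∧ ∃ a : 𝓞 K, P ^ h = Ideal.span {a} := by
  have hP' : P ∈ nonZeroDivisors (Ideal (𝓞 K)) := mem_nonZeroDivisors_of_ne_zero hP
  refine ⟨Fintype.card (ClassGroup (𝓞 K)), Fintype.card_ne_zero, ?_⟩
  have h : ClassGroup.mk0 (⟨P, hP'⟩ ^ Fintype.card (ClassGroup (𝓞 K))) = 1 := by
    rw [map_pow, pow_card_eq_one]
  obtain ⟨a, ha⟩ := (ClassGroup.mk0_eq_one_iff (pow_mem hP' _)).1 h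
  exact ⟨a, ha⟩

/-- If `P ^ h = (a)` for a prime ideal `P`, then the `h`-th power of any nonzero integer is a
power of `a` times an integer outside `P`. -/
theorem exists_pow_eq_pow_mul {R : Type*} [CommRing R] [IsDedekindDomain R] {P : Ideal R}
    [P.IsPrime] {h : ℕ} {a : R} (ha : P ^ h = Ideal.span {a}) (hP : P ≠ ⊥)
    {x : R} (hx : x ≠ 0) : ∃ (k : ℕ) (s : R), s ∉ P ∧ x ^ h = a ^ k * s := by
  obtain ⟨k, J, hJ, hxJ⟩ := WfDvdMonoid.max_power_factor' (a₀ := Ideal.span {x}) (x := P)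
    (by simpa using hx) (fun h => Ideal.IsPrime.ne_top ‹_› (Ideal.isUnit_iff.1 h))
  have hxh : Ideal.span {x ^ h} = Ideal.span {a ^ k} * J ^ h := by
    rw [← Ideal.span_singleton_pow, ← Ideal.span_singleton_pow, hxJ, mul_pow, ← ha, ← pow_mul,
      ← pow_mul, mul_comm k]
  obtain ⟨s, hs⟩ := Ideal.span_singleton_le_span_singleton.1
    (hxh.trans_le Ideal.mul_le_left)
  refine ⟨k, s, fun hsP => hJ ?_, hs⟩
  rw [hs, ← Ideal.span_singleton_mul_span_singleton] at hxh
  have ha0 : Ideal.span {a ^ k} ≠ 0 := by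
    rw [← Ideal.span_singleton_pow, ← ha]
    exact pow_ne_zero _ (pow_ne_zero _ hP)
  have hsJ := mul_left_cancel₀ ha0 hxh
  have : J ^ h ≤ P := by
    rw [← hsJ, Ideal.span_singleton_le_iff_mem]
    exact hsP
  exact Ideal.dvd_iff_le.2 (Ideal.IsPrime.le_of_pow_le this)

/-- For every `p`-adic absolute value `w` of a number field there is an element that has nontrivial
absolute value at no nonarchimedean place other than `w`. -/
theorem exists_forall_ne_one_imp_eq {K : Type*} [Field K] [NumberField K] {p : ℕ} [Fact p.Prime]
    {w : AbsoluteValue K ℝ} (hw : ∀ q : ℚ, w (algebraMap ℚ K q) = padicNorm p q) :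
    ∃ a : K, a ≠ 0 ∧ w a < 1 ∧ ∀ (p' : ℕ) [Fact p'.Prime] (w' : AbsoluteValue K ℝ),
      (∀ q : ℚ, w' (algebraMap ℚ K q) = padicNorm p' q) → w' a ≠ 1 → w' = w := by
  have := isUltrametricDist_of_eq_padicNorm hw
  have hpw : w (p : K) < 1 := by
    have := hw p
    rw [map_natCast] at this
    rw [this]
    exact_mod_cast padicNorm.padicNorm_p_lt_one_of_prime
  have hpP : (p : 𝓞 K) ∈ ltOneIdeal w := by rw [mem_ltOneIdeal]; simpa using hpw
  have hp0 : (p : 𝓞 K) ≠ 0 := Nat.cast_ne_zero.2 (Fact.out : p.Prime).ne_zero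
  have hP : ltOneIdeal w ≠ ⊥ := fun h => hp0 (by simpa [h] using hpP)
  obtain ⟨h, h0, a, ha⟩ := exists_pow_eq_span_singleton hP
  have ha0 : a ≠ 0 := by
    rintro rfl
    refine pow_ne_zero h hP ?_
    simpa using ha
  refine ⟨a, by simpa using ha0, ?_, fun p' _ w' hw' haw' => ?_⟩
  · rw [← mem_ltOneIdeal]
    exact Ideal.pow_le_self h0 (ha ▸ Ideal.mem_span_singleton_self a)
  have := isUltrametricDist_of_eq_padicNorm hw'
  have haP : a ∈ ltOneIdeal w' := by
    by_contra hc
    exact haw' (notMem_ltOneIdeal.1 hc)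
  have hPP : ltOneIdeal w = ltOneIdeal w' := by
    refine (Ideal.IsPrime.isMaximal inferInstance hP).eq_of_le (Ideal.IsPrime.ne_top inferInstance)
      (Ideal.IsPrime.le_of_pow_le (n := h) ?_)
    rw [ha, Ideal.span_singleton_le_iff_mem]
    exact haP
  have hww : ∀ q : ℚ, w' (algebraMap ℚ K q) = w (algebraMap ℚ K q) := by
    suffices p = p' by subst this; intro q; rw [hw, hw']
    by_contra hne
    have h1 : w' (p : K) < 1 := by
      have : (p : 𝓞 K) ∈ ltOneIdeal w' := hPP ▸ hpP
      simpa using mem_ltOneIdeal.1 this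
    have h2 := hw' p
    rw [map_natCast, padicNorm.padicNorm_of_prime_of_ne (Ne.symm hne)] at h2
    norm_num [h2] at h1
  have key : ∀ x : 𝓞 K, x ≠ 0 → ∃ k : ℕ, w x ^ h = w a ^ k ∧ w' x ^ h = w' a ^ k := by
    intro x hx
    obtain ⟨k, s, hs, hxs⟩ := exists_pow_eq_pow_mul ha hP hx
    have hxs' : (x : K) ^ h = (a : K) ^ k * s := by exact_mod_cast congrArg (algebraMap (𝓞 K) K) hxs
    refine ⟨k, ?_, ?_⟩
    · rw [← map_pow, hxs', map_mul, map_pow, (notMem_ltOneIdeal (x := s)).1 hs, mul_one]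
    · rw [← map_pow, hxs', map_mul, map_pow, (notMem_ltOneIdeal (x := s)).1 (hPP ▸ hs), mul_one]
  have haa : w' a = w a := by
    obtain ⟨k, hk, hk'⟩ := key p hp0
    have hk0 : k ≠ 0 := by
      rintro rfl
      rw [pow_zero] at hk
      exact (pow_lt_one₀ (w.nonneg _) (mem_ltOneIdeal.1 hpP) h0).ne hk
    have hpp : w' ((p : 𝓞 K) : K) = w ((p : 𝓞 K) : K) := by simpa using hww p
    exact (pow_left_inj₀ (w'.nonneg _) (w.nonneg _) hk0).1 (by rw [← hk, ← hk', hpp])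
  have hint : ∀ x : 𝓞 K, w' x = w x := by
    intro x
    rcases eq_or_ne x 0 with rfl | hx
    · simp
    obtain ⟨k, hk, hk'⟩ := key x hx
    exact (pow_left_inj₀ (w'.nonneg _) (w.nonneg _) h0).1 (by rw [hk, hk', haa])
  ext x
  obtain ⟨b, c, -, rfl⟩ := IsFractionRing.div_surjective (A := 𝓞 K) x
  rw [map_div₀, map_div₀, hint, hint]

open Polynomial

instance isAlgebraic_algebraicClosure_rat : Algebra.IsAlgebraic ℚ (AlgebraicClosure ℚ) := by
  convert AlgebraicClosure.isAlgebraic ℚ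
  · rfl
  · exact Subsingleton.elim _ _

instance normal_algebraicClosure_rat : Normal ℚ (AlgebraicClosure ℚ) :=
  normal_iff.2 fun x => ⟨(Algebra.IsAlgebraic.isAlgebraic x).isIntegral, IsAlgClosed.splits _⟩

theorem numberField_of_finiteDimensional (K : IntermediateField ℚ (AlgebraicClosure ℚ))
    [FiniteDimensional ℚ K] : NumberField K where
  to_charZero := inferInstance
  to_finiteDimensional := by
    convert ‹FiniteDimensional ℚ K›

theorem MeasureTheory.Integrable.abs_sub {X : Type*} [MeasurableSpace X] {μ : Measure X}
    {f g : X → ℝ} (hf : Integrable f μ) (hg : Integrable g μ) :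
    Integrable (fun x => |f x - g x|) μ :=
  (hf.sub hg).abs

/-- The logarithm of the absolute value of `α`, as a function of the place. -/
noncomputable def logAbs {Y : Type*} (absv : Y → AbsoluteValue (AlgebraicClosure ℚ) ℝ)
    (α : AlgebraicClosure ℚ) (y : Y) : ℝ :=
  Real.log (absv y α)

/-- The restriction of the absolute value at `y` to a subfield. -/
noncomputable def resAbs {Y : Type*} (absv : Y → AbsoluteValue (AlgebraicClosure ℚ) ℝ)
    (K : IntermediateField ℚ (AlgebraicClosure ℚ)) (y : Y) : AbsoluteValue K ℝ :=
  (absv y).comp (algebraMap K (AlgebraicClosure ℚ)).injective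

theorem resAbs_eq_of_le {Y : Type*} {absv : Y → AbsoluteValue (AlgebraicClosure ℚ) ℝ}
    {K L : IntermediateField ℚ (AlgebraicClosure ℚ)} (hKL : K ≤ L) {y y' : Y}
    (hyy : resAbs absv L y = resAbs absv L y') : resAbs absv K y = resAbs absv K y' :=
  AbsoluteValue.ext fun x => DFunLike.congr_fun hyy (IntermediateField.inclusion hKL x)

/-- The space of places of `AlgebraicClosure ℚ` with its Galois invariant measure. -/
structure IsPlaceSpace {Y : Type*} [TopologicalSpace Y] [MeasurableSpace Y]
    [MulAction (AlgebraicClosure ℚ ≃ₐ[ℚ] AlgebraicClosure ℚ) Y]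
    (absv : Y → AbsoluteValue (AlgebraicClosure ℚ) ℝ)
    (ratPlace : Y → Option Nat.Primes) (lam : Measure Y) : Prop where
  arch : ∀ y, ratPlace y = none →
    ∀ q : ℚ, absv y (algebraMap ℚ (AlgebraicClosure ℚ) q) = |(q : ℝ)|
  padic : ∀ y (p : Nat.Primes), ratPlace y = some p →
    ∀ q : ℚ, absv y (algebraMap ℚ (AlgebraicClosure ℚ) q) = (padicNorm p q : ℝ)
  sep : ∀ y y', (∀ x, absv y x = absv y' x) → y = y'
  exists_arch : ∀ w : AbsoluteValue (AlgebraicClosure ℚ) ℝ,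
    (∀ q : ℚ, w (algebraMap ℚ (AlgebraicClosure ℚ) q) = |(q : ℝ)|) → ∃ y, ∀ x, absv y x = w x
  isCompact_fiber : ∀ v : Option Nat.Primes, IsCompact {y | ratPlace y = v}
  isOpen_fiber : ∀ v : Option Nat.Primes, IsOpen {y | ratPlace y = v}
  absv_smul : ∀ (τ : AlgebraicClosure ℚ ≃ₐ[ℚ] AlgebraicClosure ℚ) (y : Y)
    (x : AlgebraicClosure ℚ), absv (τ • y) x = absv y (τ⁻¹ x)
  exists_smul_eq : ∀ y y' : Y, ratPlace y = ratPlace y' →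
    ∃ τ : AlgebraicClosure ℚ ≃ₐ[ℚ] AlgebraicClosure ℚ, τ • y = y'
  continuous_smul : ∀ τ : AlgebraicClosure ℚ ≃ₐ[ℚ] AlgebraicClosure ℚ,
    Continuous fun y : Y => τ • y
  continuous_logAbs : ∀ α : (AlgebraicClosure ℚ)ˣ, Continuous (logAbs absv α)
  hasCompactSupport_logAbs : ∀ α : (AlgebraicClosure ℚ)ˣ, HasCompactSupport (logAbs absv α)
  map_smul : ∀ τ : AlgebraicClosure ℚ ≃ₐ[ℚ] AlgebraicClosure ℚ,
    Measure.map (fun y : Y => τ • y) lam = lam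
  measure_fiber : ∀ v : Option Nat.Primes, lam {y | ratPlace y = v} = 1

section logAbs

variable {Y : Type*} (absv : Y → AbsoluteValue (AlgebraicClosure ℚ) ℝ)

theorem logAbs_one : logAbs absv 1 = 0 := by
  ext y; simp [logAbs]

theorem logAbs_neg (α : AlgebraicClosure ℚ) : logAbs absv (-α) = logAbs absv α := by
  ext y; simp [logAbs]

theorem logAbs_mul {α β : AlgebraicClosure ℚ} (hα : α ≠ 0) (hβ : β ≠ 0) :
    logAbs absv (α * β) = logAbs absv α + logAbs absv β := by
  ext y
  simp only [logAbs, map_mul, Pi.add_apply]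
  exact Real.log_mul ((absv y).ne_zero hα) ((absv y).ne_zero hβ)

theorem logAbs_zpow (α : AlgebraicClosure ℚ) (n : ℤ) :
    logAbs absv (α ^ n) = (n : ℝ) • logAbs absv α := by
  ext y
  simp [logAbs, Real.log_zpow]

/-- Every rational multiple of `logAbs absv α` is again the logarithm of an algebraic number. -/
theorem exists_logAbs_eq_smul (q : ℚ) (α : (AlgebraicClosure ℚ)ˣ) :
    ∃ β : (AlgebraicClosure ℚ)ˣ, logAbs absv β = (q : ℝ) • logAbs absv α := by
  obtain ⟨β, hβ⟩ := IsAlgClosed.exists_pow_nat_eq ((α : AlgebraicClosure ℚ) ^ q.num) q.den_pos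
  have hβ0 : β ≠ 0 := by
    rintro rfl
    rw [zero_pow q.den_ne_zero] at hβ
    exact zpow_ne_zero _ α.ne_zero hβ.symm
  refine ⟨Units.mk0 β hβ0, ?_⟩
  have h := logAbs_zpow absv β q.den
  rw [zpow_natCast, hβ, logAbs_zpow] at h
  have hd : (q.den : ℝ) ≠ 0 := by exact_mod_cast q.den_ne_zero
  ext y
  have hy := congrFun h y
  simp only [Pi.smul_apply, smul_eq_mul, Int.cast_natCast] at hy
  rw [Units.val_mk0, Pi.smul_apply, smul_eq_mul, Rat.cast_def, div_mul_eq_mul_div, hy]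
  field_simp

end logAbs

namespace IsPlaceSpace

variable {Y : Type*} [TopologicalSpace Y] [MeasurableSpace Y]
    [MulAction (AlgebraicClosure ℚ ≃ₐ[ℚ] AlgebraicClosure ℚ) Y]
    {absv : Y → AbsoluteValue (AlgebraicClosure ℚ) ℝ}
    {ratPlace : Y → Option Nat.Primes} {lam : Measure Y}

section place

variable (h : IsPlaceSpace absv ratPlace lam)

include h

theorem continuous_absv (x : AlgebraicClosure ℚ) : Continuous fun y => absv y x := by
  rcases eq_or_ne x 0 with rfl | hx
  · simpa using continuous_const
  refine (Real.continuous_exp.comp (h.continuous_logAbs (Units.mk0 x hx))).congr fun y => ?_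
  exact Real.exp_log ((absv y).pos hx)

theorem ratPlace_eq {y y' : Y} (hyy : ∀ q : ℚ, absv y (algebraMap ℚ (AlgebraicClosure ℚ) q) =
    absv y' (algebraMap ℚ (AlgebraicClosure ℚ) q)) : ratPlace y = ratPlace y' := by
  have key : ∀ {y y' : Y} {p : Nat.Primes}, (∀ q : ℚ, absv y (algebraMap ℚ _ q) =
      absv y' (algebraMap ℚ _ q)) → ratPlace y = some p → ratPlace y' = some p := by
    intro y y' p hyy hy
    have : Fact (p : ℕ).Prime := ⟨p.2⟩
    have hp := h.padic y p hy p
    have hlt : (padicNorm p p : ℝ) < 1 := by exact_mod_cast padicNorm.padicNorm_p_lt_one_of_prime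
    rw [hyy] at hp
    rcases hy' : ratPlace y' with _ | p'
    · rw [h.arch y' hy'] at hp
      rw [← hp] at hlt
      have hp1 : (1 : ℝ) ≤ (p : ℕ) := by exact_mod_cast p.2.one_le
      rw [Rat.cast_natCast, Nat.abs_cast] at hlt
      linarith
    · have : Fact (p' : ℕ).Prime := ⟨p'.2⟩
      rw [h.padic y' p' hy'] at hp
      by_contra hne
      have hne' : (p' : ℕ) ≠ p := fun hc => hne (congrArg some (Subtype.ext hc))
      rw [padicNorm.padicNorm_of_prime_of_ne hne'] at hp
      rw [← hp] at hlt
      norm_num at hlt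
  rcases hy : ratPlace y with _ | p
  · rcases hy' : ratPlace y' with _ | p'
    · rfl
    · rw [key (fun q => (hyy q).symm) hy'] at hy
      cases hy
  · exact (key hyy hy).symm

theorem ratPlace_eq_of_resAbs {K : IntermediateField ℚ (AlgebraicClosure ℚ)} {y y' : Y}
    (hyy : resAbs absv K y = resAbs absv K y') : ratPlace y = ratPlace y' :=
  h.ratPlace_eq fun q => DFunLike.congr_fun hyy (algebraMap ℚ K q)

theorem finite_resAbs (K : IntermediateField ℚ (AlgebraicClosure ℚ)) [FiniteDimensional ℚ K]
    (v : Option Nat.Primes) : (resAbs absv K '' {y | ratPlace y = v}).Finite := by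
  rcases Set.eq_empty_or_nonempty {y | ratPlace y = v} with he | ⟨y₀, hy₀⟩
  · simp [he]
  refine (Set.finite_range fun φ : K →ₐ[ℚ] AlgebraicClosure ℚ =>
    (absv y₀).comp φ.toRingHom.injective).subset ?_
  rintro _ ⟨y, hy, rfl⟩
  obtain ⟨τ, rfl⟩ := h.exists_smul_eq y₀ y (hy₀.trans hy.symm)
  refine ⟨((τ⁻¹ : AlgebraicClosure ℚ ≃ₐ[ℚ] AlgebraicClosure ℚ) :
    AlgebraicClosure ℚ →ₐ[ℚ] AlgebraicClosure ℚ).comp K.val, ?_⟩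
  ext x
  exact (h.absv_smul τ y₀ x).symm

theorem isClosed_resAbs_eq (K : IntermediateField ℚ (AlgebraicClosure ℚ))
    (a : AbsoluteValue K ℝ) : IsClosed {y | resAbs absv K y = a} := by
  have : {y | resAbs absv K y = a} = ⋂ x : K, {y | absv y x = a x} := by
    ext y
    simp only [Set.mem_ofPred_eq, Set.mem_iInter]
    exact DFunLike.ext_iff
  rw [this]
  exact isClosed_iInter fun x => isClosed_eq (h.continuous_absv x) continuous_const

theorem isOpen_resAbs_eq (K : IntermediateField ℚ (AlgebraicClosure ℚ)) [FiniteDimensional ℚ K]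
    (y₀ : Y) : IsOpen {y | resAbs absv K y = resAbs absv K y₀} := by
  have hS := (h.finite_resAbs K (ratPlace y₀)).subset
    (Set.sdiff_subset (t := {resAbs absv K y₀}))
  have : {y | resAbs absv K y = resAbs absv K y₀} = {y | ratPlace y = ratPlace y₀} \
      ⋃ a ∈ (resAbs absv K '' {y | ratPlace y = ratPlace y₀}) \ {resAbs absv K y₀},
        {y | resAbs absv K y = a} := by
    ext y
    simp only [Set.mem_ofPred_eq, Set.mem_sdiff, Set.mem_iUnion, Set.mem_image,
      Set.mem_singleton_iff, exists_prop, not_exists, not_and]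
    constructor
    · intro hy
      refine ⟨h.ratPlace_eq_of_resAbs hy, fun a ha haa => ha.2 (haa.symm.trans hy)⟩
    · intro hy
      by_contra hne
      exact hy.2 _ ⟨⟨y, hy.1, rfl⟩, hne⟩ rfl
  rw [this]
  exact (h.isOpen_fiber _).sdiff (hS.isClosed_biUnion fun a _ => h.isClosed_resAbs_eq K a)

variable [BorelSpace Y]

theorem measure_resAbs_eq_pos (K : IntermediateField ℚ (AlgebraicClosure ℚ))
    [FiniteDimensional ℚ K] (y₀ : Y) : 0 < lam {y | resAbs absv K y = resAbs absv K y₀} := by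
  rw [pos_iff_ne_zero]
  intro h0
  have hz : lam {y | ratPlace y = ratPlace y₀} = 0 := by
    refine (h.isCompact_fiber _).measure_zero_of_nhdsWithin fun y hy => ?_
    obtain ⟨τ, rfl⟩ := h.exists_smul_eq y₀ y hy.symm
    have ho := h.isOpen_resAbs_eq K y₀
    refine ⟨(fun y => τ⁻¹ • y) ⁻¹' {y | resAbs absv K y = resAbs absv K y₀},
      mem_nhdsWithin_of_mem_nhds ((ho.preimage (h.continuous_smul _)).mem_nhds (by simp)), ?_⟩
    rw [← Measure.map_apply (h.continuous_smul _).measurable ho.measurableSet, h.map_smul, h0]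
  rw [h.measure_fiber] at hz
  exact one_ne_zero hz

theorem measurableSet_fiber (v : Option Nat.Primes) : MeasurableSet {y | ratPlace y = v} :=
  (h.isOpen_fiber v).measurableSet

theorem integrable_indicator_fiber (v : Option Nat.Primes) (c : ℝ) :
    Integrable ({y | ratPlace y = v}.indicator fun _ => c) lam :=
  (integrable_indicator_iff (h.measurableSet_fiber v)).2
    (integrableOn_const (by simp [h.measure_fiber]))

theorem integral_indicator_fiber (v : Option Nat.Primes) (c : ℝ) :
    ∫ y, {y | ratPlace y = v}.indicator (fun _ => c) y ∂lam = c := by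
  rw [integral_indicator_const _ (h.measurableSet_fiber v)]
  simp [Measure.real, h.measure_fiber]

end place

section productFormula

variable (h : IsPlaceSpace absv ratPlace lam) [BorelSpace Y]

include h

theorem integral_logAbs_algEquiv (τ : AlgebraicClosure ℚ ≃ₐ[ℚ] AlgebraicClosure ℚ)
    {α : AlgebraicClosure ℚ} (hα : α ≠ 0) :
    ∫ y, logAbs absv (τ α) y ∂lam = ∫ y, logAbs absv α y ∂lam := by
  have hm := (h.continuous_smul τ⁻¹).measurable
  conv_rhs => rw [← h.map_smul τ⁻¹]
  rw [integral_map (f := logAbs absv α) hm.aemeasurable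
    (h.continuous_logAbs (Units.mk0 α hα)).measurable.aestronglyMeasurable]
  refine integral_congr_ae (.of_forall fun y => ?_)
  simp [logAbs, h.absv_smul]

theorem integral_logAbs_prime (l : Nat.Primes) :
    ∫ y, logAbs absv ((l : ℕ) : AlgebraicClosure ℚ) y ∂lam = 0 := by
  have : logAbs absv ((l : ℕ) : AlgebraicClosure ℚ) =
      {y | ratPlace y = none}.indicator (fun _ => Real.log l) +
        {y | ratPlace y = some l}.indicator (fun _ => -Real.log l) := by
    ext y
    have hl : ((l : ℕ) : AlgebraicClosure ℚ) = algebraMap ℚ _ (l : ℕ) := by simp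
    have : Fact (l : ℕ).Prime := ⟨l.2⟩
    rw [logAbs, hl, Pi.add_apply]
    rcases hy : ratPlace y with _ | p
    · rw [h.arch y hy]
      simp [hy, Set.indicator]
    · have : Fact (p : ℕ).Prime := ⟨p.2⟩
      rw [h.padic y p hy]
      by_cases hpl : p = l
      · subst hpl
        simp [hy, Set.indicator, padicNorm.padicNorm_p_of_prime]
      · have hne : (p : ℕ) ≠ l := fun hc => hpl (Subtype.ext hc)
        rw [padicNorm.padicNorm_of_prime_of_ne hne]
        simp [hy, Set.indicator, hpl]
  rw [this]
  simp only [Pi.add_apply]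
  rw [integral_add (h.integrable_indicator_fiber _ _) (h.integrable_indicator_fiber _ _),
    h.integral_indicator_fiber, h.integral_indicator_fiber, add_neg_cancel]

variable [IsFiniteMeasureOnCompacts lam]

theorem integrable_logAbs {α : AlgebraicClosure ℚ} (hα : α ≠ 0) :
    Integrable (logAbs absv α) lam :=
  (h.continuous_logAbs (Units.mk0 α hα)).integrable_of_hasCompactSupport
    (h.hasCompactSupport_logAbs (Units.mk0 α hα))

theorem integral_logAbs_mul {α β : AlgebraicClosure ℚ} (hα : α ≠ 0) (hβ : β ≠ 0) :
    ∫ y, logAbs absv (α * β) y ∂lam =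
      ∫ y, logAbs absv α y ∂lam + ∫ y, logAbs absv β y ∂lam := by
  rw [logAbs_mul absv hα hβ]
  exact integral_add (h.integrable_logAbs hα) (h.integrable_logAbs hβ)

theorem integral_logAbs_natCast {n : ℕ} (hn : n ≠ 0) :
    ∫ y, logAbs absv (n : AlgebraicClosure ℚ) y ∂lam = 0 := by
  induction n using Nat.recOnMul with
  | zero => exact absurd rfl hn
  | one => simp [logAbs_one]
  | prime p hp => exact h.integral_logAbs_prime ⟨p, hp⟩
  | mul a b iha ihb =>
    obtain ⟨ha, hb⟩ := mul_ne_zero_iff.1 hn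
    rw [Nat.cast_mul, h.integral_logAbs_mul (Nat.cast_ne_zero.2 ha) (Nat.cast_ne_zero.2 hb),
      iha ha, ihb hb, add_zero]

theorem integral_logAbs_algebraMap {q : ℚ} (hq : q ≠ 0) :
    ∫ y, logAbs absv (algebraMap ℚ (AlgebraicClosure ℚ) q) y ∂lam = 0 := by
  have hmul : algebraMap ℚ (AlgebraicClosure ℚ) q * (q.den : ℕ) = (q.num : ℤ) := by
    rw [← map_natCast (algebraMap ℚ (AlgebraicClosure ℚ)), ← map_mul, Rat.mul_den_eq_num,
      map_intCast]
  have hnum : ∫ y, logAbs absv ((q.num : ℤ) : AlgebraicClosure ℚ) y ∂lam = 0 := by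
    have h0 := h.integral_logAbs_natCast (Int.natAbs_ne_zero.2 (Rat.num_ne_zero.2 hq))
    rcases Int.natAbs_eq q.num with hq' | hq' <;> rw [hq']
    · simpa using h0
    · rw [Int.cast_neg, logAbs_neg]
      simpa using h0
  rw [← hmul, h.integral_logAbs_mul (by simpa using hq) (by simp),
    h.integral_logAbs_natCast q.den_ne_zero, add_zero] at hnum
  exact hnum

theorem integral_logAbs_multiset_prod {c : ℝ} (s : Multiset (AlgebraicClosure ℚ))
    (hs : ∀ r ∈ s, r ≠ 0 ∧ ∫ y, logAbs absv r y ∂lam = c) :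
    s.prod ≠ 0 ∧ ∫ y, logAbs absv s.prod y ∂lam = s.card * c := by
  induction s using Multiset.induction with
  | empty => simp [logAbs_one]
  | cons a s ih =>
    obtain ⟨h1, h2⟩ := ih fun r hr => hs r (Multiset.mem_cons_of_mem hr)
    obtain ⟨h3, h4⟩ := hs a (Multiset.mem_cons_self a s)
    rw [Multiset.prod_cons]
    refine ⟨mul_ne_zero h3 h1, ?_⟩
    rw [h.integral_logAbs_mul h3 h1, h2, h4, Multiset.card_cons]
    push_cast
    ring

/-- The product formula. -/
theorem integral_logAbs {α : AlgebraicClosure ℚ} (hα : α ≠ 0) :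
    ∫ y, logAbs absv α y ∂lam = 0 := by
  have hint : IsIntegral ℚ α := (Algebra.IsAlgebraic.isAlgebraic α).isIntegral
  set f := (minpoly ℚ α).map (algebraMap ℚ (AlgebraicClosure ℚ)) with hf
  have hmonic : f.Monic := (minpoly.monic hint).map _
  have hsplit : f.Splits := IsAlgClosed.splits f
  obtain ⟨h1, h2⟩ := h.integral_logAbs_multiset_prod (c := ∫ y, logAbs absv α y ∂lam) f.roots (by
    intro r hr
    have hr' : r ∈ (minpoly ℚ α).aroots (AlgebraicClosure ℚ) := hr
    have hconj : IsConjRoot ℚ α r := (isConjRoot_iff_mem_minpoly_aroots hint).2 hr'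
    obtain ⟨σ, rfl⟩ := isConjRoot_iff_exists_algEquiv.1 hconj.symm
    exact ⟨by simpa using hα, h.integral_logAbs_algEquiv σ hα⟩)
  have h3 : logAbs absv f.roots.prod =
      logAbs absv (algebraMap ℚ (AlgebraicClosure ℚ) ((minpoly ℚ α).coeff 0)) := by
    rw [← coeff_map, ← hf, hsplit.coeff_zero_eq_prod_roots_of_monic hmonic]
    rcases neg_one_pow_eq_or (AlgebraicClosure ℚ) f.natDegree with hs | hs <;> rw [hs]
    · rw [one_mul]
    · rw [neg_one_mul, logAbs_neg]
  rw [h3, h.integral_logAbs_algebraMap (minpoly.coeff_zero_ne_zero hint hα)] at h2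
  rw [← hsplit.natDegree_eq_card_roots, hf, natDegree_map] at h2
  have hdeg : ((minpoly ℚ α).natDegree : ℝ) ≠ 0 := by
    exact_mod_cast (minpoly.natDegree_pos hint).ne'
  exact (mul_eq_zero.1 h2.symm).resolve_left hdeg

end productFormula

section closure

variable [BorelSpace Y] [IsFiniteMeasureOnCompacts lam]

/-- The closure, in the `L¹` seminorm, of the set of functions `logAbs absv α`. -/
def logClosure (h : IsPlaceSpace absv ratPlace lam) : Submodule ℝ (Y → ℝ) where
  carrier := {F | Integrable F lam ∧ ∀ ε : ℝ, 0 < ε →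
    ∃ α : (AlgebraicClosure ℚ)ˣ, ∫ y, |F y - logAbs absv α y| ∂lam < ε}
  zero_mem' := ⟨integrable_zero _ _ _, fun ε hε => ⟨1, by simpa [logAbs_one] using hε⟩⟩
  add_mem' := by
    rintro F G ⟨hF, hF'⟩ ⟨hG, hG'⟩
    refine ⟨hF.add hG, fun ε hε => ?_⟩
    obtain ⟨α, hα⟩ := hF' (ε / 2) (half_pos hε)
    obtain ⟨β, hβ⟩ := hG' (ε / 2) (half_pos hε)
    have iα := hF.abs_sub (h.integrable_logAbs α.ne_zero)
    have iβ := hG.abs_sub (h.integrable_logAbs β.ne_zero)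
    refine ⟨α * β, lt_of_le_of_lt ?_ ((add_lt_add hα hβ).trans_eq (add_halves ε))⟩
    rw [← integral_add iα iβ, Units.val_mul, logAbs_mul absv α.ne_zero β.ne_zero]
    refine integral_mono_of_nonneg (.of_forall fun y => abs_nonneg _) (iα.add iβ)
      (.of_forall fun y => ?_)
    simp only [Pi.add_apply]
    rw [add_sub_add_comm]
    exact abs_add_le _ _
  smul_mem' := by
    rintro r F ⟨hF, hF'⟩
    refine ⟨hF.smul r, fun ε hε => ?_⟩
    have hN : 0 ≤ ∫ y, |F y| ∂lam := integral_nonneg fun y => abs_nonneg _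
    set N := ∫ y, |F y| ∂lam
    have hδ : 0 < ε / 2 / (N + 1) := by positivity
    obtain ⟨q, hq, hq'⟩ := exists_rat_btwn (lt_add_of_pos_right r hδ)
    obtain ⟨α, hα⟩ := hF' (ε / 2 / (|(q : ℝ)| + 1)) (by positivity)
    obtain ⟨β, hβ⟩ := exists_logAbs_eq_smul absv q α
    have iα := hF.abs_sub (h.integrable_logAbs α.ne_zero)
    refine ⟨β, ?_⟩
    have h1 : ∫ y, |(r • F) y - logAbs absv β y| ∂lam ≤
        |r - q| * N + |(q : ℝ)| * ∫ y, |F y - logAbs absv α y| ∂lam := by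
      rw [← integral_const_mul, ← integral_const_mul, ← integral_add (hF.abs.const_mul _)
        (iα.const_mul _)]
      refine integral_mono_of_nonneg (.of_forall fun y => abs_nonneg _)
        ((hF.abs.const_mul _).add (iα.const_mul _)) (.of_forall fun y => ?_)
      simp only [hβ, Pi.smul_apply, smul_eq_mul]
      rw [← abs_mul, ← abs_mul]
      refine le_of_eq_of_le (congrArg _ ?_) (abs_add_le _ _)
      ring
    have h2 : |r - q| * N ≤ ε / 2 := by
      have hrq : |r - q| ≤ ε / 2 / (N + 1) := by
        rw [abs_sub_comm, abs_of_pos (sub_pos.2 hq)]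
        linarith
      calc |r - q| * N ≤ ε / 2 / (N + 1) * (N + 1) := by gcongr; linarith
        _ = ε / 2 := by field_simp
    have h3 : |(q : ℝ)| * ∫ y, |F y - logAbs absv α y| ∂lam < ε / 2 := by
      have hq0 := abs_nonneg (q : ℝ)
      have hA : 0 ≤ ∫ y, |F y - logAbs absv α y| ∂lam := integral_nonneg fun y => abs_nonneg _
      rw [lt_div_iff₀ (by positivity)] at hα
      rcases hA.eq_or_lt with hA | hA
      · rw [← hA, mul_zero]; positivity
      · nlinarith
    linarith

theorem logAbs_mem_logClosure (h : IsPlaceSpace absv ratPlace lam) {α : AlgebraicClosure ℚ}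
    (hα : α ≠ 0) : logAbs absv α ∈ h.logClosure :=
  ⟨h.integrable_logAbs hα, fun ε hε => ⟨Units.mk0 α hα, by simpa using hε⟩⟩

theorem integrable_of_mem_logClosure (h : IsPlaceSpace absv ratPlace lam) {F : Y → ℝ}
    (hF : F ∈ h.logClosure) : Integrable F lam :=
  hF.1

theorem integral_eq_zero_of_mem_logClosure (h : IsPlaceSpace absv ratPlace lam) {F : Y → ℝ}
    (hF : F ∈ h.logClosure) : ∫ y, F y ∂lam = 0 := by
  by_contra hne
  obtain ⟨α, hα⟩ := hF.2 |∫ y, F y ∂lam| (abs_pos.2 hne)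
  have := abs_integral_le_integral_abs (f := fun y => F y - logAbs absv α y) (μ := lam)
  rw [integral_sub hF.1 (h.integrable_logAbs α.ne_zero), h.integral_logAbs α.ne_zero,
    sub_zero] at this
  exact absurd hα this.not_gt

theorem mem_logClosure_of_forall (h : IsPlaceSpace absv ratPlace lam) {F : Y → ℝ}
    (hF : Integrable F lam) (hF' : ∀ ε : ℝ, 0 < ε → ∃ G ∈ h.logClosure,
      ∫ y, |F y - G y| ∂lam < ε) : F ∈ h.logClosure := by
  refine ⟨hF, fun ε hε => ?_⟩
  obtain ⟨G, hG, hFG⟩ := hF' (ε / 2) (half_pos hε)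
  obtain ⟨α, hα⟩ := hG.2 (ε / 2) (half_pos hε)
  have i1 := hF.abs_sub hG.1
  have i2 := hG.1.abs_sub (h.integrable_logAbs α.ne_zero)
  refine ⟨α, lt_of_le_of_lt ?_ ((add_lt_add hFG hα).trans_eq (add_halves ε))⟩
  rw [← integral_add i1 i2]
  exact integral_mono_of_nonneg (.of_forall fun y => abs_nonneg _) (i1.add i2)
    (.of_forall fun y => abs_sub_le _ _ _)

/-- The submodule of functions that become limits of logarithms of algebraic numbers once their
integral is corrected on the archimedean fiber. -/
def centeredClosure (h : IsPlaceSpace absv ratPlace lam) : Submodule ℝ (Y → ℝ) where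
  carrier := {F | Integrable F lam ∧
    F - {y | ratPlace y = none}.indicator (fun _ => ∫ y, F y ∂lam) ∈ h.logClosure}
  zero_mem' := ⟨integrable_zero _ _ _, by
    convert h.logClosure.zero_mem using 1
    ext y
    simp⟩
  add_mem' := by
    rintro F G ⟨hF, hF'⟩ ⟨hG, hG'⟩
    refine ⟨hF.add hG, ?_⟩
    convert h.logClosure.add_mem hF' hG' using 1
    ext y
    by_cases hy : ratPlace y = none
    · simp only [Pi.add_apply, Pi.sub_apply, Set.indicator, Set.mem_ofPred_eq, hy, if_true]
      rw [integral_add hF hG]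
      ring
    · simp [Set.indicator, hy]
  smul_mem' := by
    rintro r F ⟨hF, hF'⟩
    refine ⟨hF.smul r, ?_⟩
    convert h.logClosure.smul_mem r hF' using 1
    ext y
    by_cases hy : ratPlace y = none
    · simp only [Pi.smul_apply, Pi.sub_apply, Set.indicator, Set.mem_ofPred_eq, hy, if_true,
        smul_eq_mul]
      rw [integral_const_mul]
      ring
    · simp [Set.indicator, hy]

theorem mem_centeredClosure_of_forall (h : IsPlaceSpace absv ratPlace lam) {F : Y → ℝ}
    (hF : Integrable F lam) (hF' : ∀ ε : ℝ, 0 < ε → ∃ G ∈ h.centeredClosure,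
      ∫ y, |F y - G y| ∂lam ≤ ε) : F ∈ h.centeredClosure := by
  refine ⟨hF, h.mem_logClosure_of_forall (hF.sub (h.integrable_indicator_fiber _ _))
    fun ε hε => ?_⟩
  obtain ⟨G, hG, hFG⟩ := hF' (ε / 3) (by positivity)
  refine ⟨_, hG.2, ?_⟩
  have i1 := hF.abs_sub hG.1
  have i2 := h.integrable_indicator_fiber none |∫ y, F y ∂lam - ∫ y, G y ∂lam|
  have h1 : ∫ y, |(F - {y | ratPlace y = none}.indicator fun _ => ∫ y, F y ∂lam) y -
      (G - {y | ratPlace y = none}.indicator fun _ => ∫ y, G y ∂lam) y| ∂lam ≤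
      ∫ y, |F y - G y| ∂lam + |∫ y, F y ∂lam - ∫ y, G y ∂lam| := by
    conv_rhs => rw [← h.integral_indicator_fiber none |∫ y, F y ∂lam - ∫ y, G y ∂lam|]
    rw [← integral_add i1 i2]
    refine integral_mono_of_nonneg (.of_forall fun y => abs_nonneg _) (i1.add i2)
      (.of_forall fun y => ?_)
    by_cases hy : ratPlace y = none
    · simp only [Pi.sub_apply, Set.indicator, Set.mem_ofPred_eq, hy, if_true]
      rw [sub_sub_sub_comm]
      exact abs_sub _ _
    · simp [Set.indicator, hy]
  have h2 : |∫ y, F y ∂lam - ∫ y, G y ∂lam| ≤ ∫ y, |F y - G y| ∂lam := by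
    rw [← integral_sub hF hG.1]
    exact abs_integral_le_integral_abs
  linarith

end closure

section level

variable (h : IsPlaceSpace absv ratPlace lam)

include h

theorem exists_infinitePlace_eq (K : IntermediateField ℚ (AlgebraicClosure ℚ)) {y : Y}
    (hy : ratPlace y = none) : ∃ w : InfinitePlace K, ∀ x : K, w x = absv y x := by
  let φ : AlgebraicClosure ℚ →ₐ[ℚ] ℂ := IsAlgClosed.lift
  have hφ : ∀ q : ℚ, place φ.toRingHom (algebraMap ℚ _ q) = |(q : ℝ)| := fun q => by
    change ‖φ (algebraMap ℚ _ q)‖ = _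
    rw [AlgHom.commutes]
    simp
  obtain ⟨y₀, hy₀⟩ := h.exists_arch (place φ.toRingHom) hφ
  have hr : ratPlace y₀ = ratPlace y := h.ratPlace_eq fun q => by rw [hy₀, hφ, h.arch y hy]
  obtain ⟨τ, rfl⟩ := h.exists_smul_eq y₀ y hr
  let τ' : AlgebraicClosure ℚ ≃ₐ[ℚ] AlgebraicClosure ℚ := τ⁻¹
  refine ⟨InfinitePlace.mk ((φ.toRingHom.comp (τ' : AlgebraicClosure ℚ →+* AlgebraicClosure ℚ)).comp
    (algebraMap K (AlgebraicClosure ℚ))), fun x => ?_⟩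
  rw [h.absv_smul, hy₀]
  rfl

theorem resAbs_algebraMap (K : IntermediateField ℚ (AlgebraicClosure ℚ)) {y : Y}
    {p : Nat.Primes} (hp : ratPlace y = some p) (q : ℚ) :
    resAbs absv K y (algebraMap ℚ K q) = padicNorm p q := by
  rw [← h.padic y p hp q, eq_ratCast, eq_ratCast]
  exact congrArg (absv y) (map_ratCast (algebraMap K (AlgebraicClosure ℚ)) q)

theorem absv_unit_eq_one {K : IntermediateField ℚ (AlgebraicClosure ℚ)} (u : (𝓞 K)ˣ) {y : Y}
    (hy : ratPlace y ≠ none) : absv y ((u : K) : AlgebraicClosure ℚ) = 1 := by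
  obtain ⟨p, hp⟩ := Option.ne_none_iff_exists'.1 hy
  have : Fact (p : ℕ).Prime := ⟨p.2⟩
  have := isUltrametricDist_of_eq_padicNorm (h.resAbs_algebraMap K hp)
  have key : ∀ u : (𝓞 K)ˣ, resAbs absv K y (u : K) ≤ 1 := fun u =>
    absoluteValue_le_one_of_isIntegral (RingOfIntegers.isIntegral_coe _)
  have hmul : resAbs absv K y (u : K) * resAbs absv K y ((u⁻¹ : (𝓞 K)ˣ) : K) = 1 := by
    rw [← map_mul]
    simp
  have h1 := key u
  have h2 := key u⁻¹
  have h3 := (resAbs absv K y).nonneg (u : K)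
  change resAbs absv K y (u : K) = 1
  nlinarith

variable [BorelSpace Y]

section

variable (K : IntermediateField ℚ (AlgebraicClosure ℚ)) [FiniteDimensional ℚ K]

theorem measureReal_resAbs_eq_pos (y₀ : Y) :
    0 < lam.real {y | resAbs absv K y = resAbs absv K y₀} := by
  refine ENNReal.toReal_pos (h.measure_resAbs_eq_pos K y₀).ne' (ne_top_of_le_ne_top ?_
    (measure_mono (t := {y | ratPlace y = ratPlace y₀}) fun y hy => h.ratPlace_eq_of_resAbs hy))
  simp [h.measure_fiber]

theorem measurableSet_resAbs_eq (y₀ : Y) :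
    MeasurableSet {y | resAbs absv K y = resAbs absv K y₀} :=
  (h.isOpen_resAbs_eq K y₀).measurableSet

theorem integrable_indicator_resAbs (y₀ : Y) (c : ℝ) :
    Integrable ({y | resAbs absv K y = resAbs absv K y₀}.indicator fun _ => c) lam :=
  (integrable_indicator_iff (h.measurableSet_resAbs_eq K y₀)).2 (integrableOn_const
    (ENNReal.toReal_pos_iff.1 (h.measureReal_resAbs_eq_pos K y₀)).2.ne)

end

variable [IsFiniteMeasureOnCompacts lam]

theorem exists_mem_logClosure_of_logSpace (K : IntermediateField ℚ (AlgebraicClosure ℚ))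
    [NumberField K] (t : Units.dirichletUnitTheorem.logSpace K) : ∃ F ∈ h.logClosure,
      (∀ y y', resAbs absv K y = resAbs absv K y' → F y = F y') ∧
      (∀ y, ratPlace y ≠ none → F y = 0) ∧
      ∀ y (w : {w : InfinitePlace K // w ≠ Units.dirichletUnitTheorem.w₀}),
        (∀ x : K, w.1 x = absv y x) → w.1.mult * F y = t w := by
  have ht : t ∈ Submodule.span ℝ (Units.unitLattice K : Set (Units.dirichletUnitTheorem.logSpace K)) := by
    rw [Units.dirichletUnitTheorem.unitLattice_span_eq_top]
    trivial
  induction ht using Submodule.span_induction with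
  | zero => exact ⟨0, zero_mem _, by simp⟩
  | mem t ht =>
    obtain ⟨u, -, rfl⟩ := ht
    refine ⟨logAbs absv ((u.toMul : K) : AlgebraicClosure ℚ), h.logAbs_mem_logClosure (by simp),
      fun y y' hyy => ?_, fun y hy => ?_, fun y w hw => ?_⟩
    · exact congrArg Real.log (DFunLike.congr_fun hyy (u.toMul : K))
    · rw [logAbs, h.absv_unit_eq_one _ hy, Real.log_one]
    · rw [logAbs, ← hw]
      rfl
  | add t s _ _ iht ihs =>
    obtain ⟨F, hF, h1, h2, h3⟩ := iht
    obtain ⟨G, hG, g1, g2, g3⟩ := ihs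
    refine ⟨F + G, add_mem hF hG, fun y y' hyy => ?_, fun y hy => ?_, fun y w hw => ?_⟩
    · rw [Pi.add_apply, Pi.add_apply, h1 y y' hyy, g1 y y' hyy]
    · rw [Pi.add_apply, h2 y hy, g2 y hy, add_zero]
    · rw [Pi.add_apply, Pi.add_apply, mul_add, h3 y w hw, g3 y w hw]
  | smul r t _ iht =>
    obtain ⟨F, hF, h1, h2, h3⟩ := iht
    refine ⟨r • F, h.logClosure.smul_mem r hF, fun y y' hyy => ?_, fun y hy => ?_,
      fun y w hw => ?_⟩
    · rw [Pi.smul_apply, Pi.smul_apply, h1 y y' hyy]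
    · rw [Pi.smul_apply, h2 y hy, smul_zero]
    · rw [Pi.smul_apply, Pi.smul_apply, mul_smul_comm, h3 y w hw]

variable (K : IntermediateField ℚ (AlgebraicClosure ℚ)) [FiniteDimensional ℚ K]

/-- Dirichlet's unit theorem: on the archimedean fiber every function of integral zero coming from
a finite level is a combination of logarithms of units. -/
theorem mem_logClosure_of_arch {g : Y → ℝ} (hg : Integrable g lam)
    (hc : ∀ y y', resAbs absv K y = resAbs absv K y' → g y = g y')
    (h0 : ∀ y, ratPlace y ≠ none → g y = 0) (hi : ∫ y, g y ∂lam = 0) : g ∈ h.logClosure := by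
  classical
  have := numberField_of_finiteDimensional K
  obtain ⟨F, hF, h1, h2, h3⟩ := h.exists_mem_logClosure_of_logSpace K fun w =>
    if hw : ∃ y, ∀ x : K, w.1 x = absv y x then w.1.mult * g hw.choose else 0
  have hval : ∀ y (w : InfinitePlace K), w ≠ Units.dirichletUnitTheorem.w₀ →
      (∀ x : K, w x = absv y x) → F y = g y := by
    intro y w hw hwy
    have h4 := h3 y ⟨w, hw⟩ hwy
    have hex : ∃ y, ∀ x : K, w x = absv y x := ⟨y, hwy⟩
    rw [dif_pos hex] at h4
    rw [mul_left_cancel₀ (Nat.cast_ne_zero.2 w.mult_pos.ne') h4]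
    exact hc _ _ (AbsoluteValue.ext fun x => (hex.choose_spec x).symm.trans (hwy x))
  suffices g = F by rwa [this]
  by_contra hne
  obtain ⟨y₀, hy₀⟩ := Function.ne_iff.1 hne
  have hr : ratPlace y₀ = none := by
    by_contra hr
    exact hy₀ ((h0 _ hr).trans (h2 _ hr).symm)
  obtain ⟨w, hw⟩ := h.exists_infinitePlace_eq K hr
  have hww : w = Units.dirichletUnitTheorem.w₀ := by
    by_contra hww
    exact hy₀ (hval _ w hww hw).symm
  have hd : (fun y => g y - F y) =
      {y | resAbs absv K y = resAbs absv K y₀}.indicator fun _ => g y₀ - F y₀ := by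
    ext y
    by_cases hy : resAbs absv K y = resAbs absv K y₀
    · rw [Set.indicator_of_mem (by exact hy), hc y y₀ hy, h1 y y₀ hy]
    · rw [Set.indicator_of_notMem (by exact hy), sub_eq_zero]
      by_cases hr' : ratPlace y = none
      · obtain ⟨w', hw'⟩ := h.exists_infinitePlace_eq K hr'
        refine (hval y w' (fun hww' => hy ?_) hw').symm
        rw [← hww] at hww'
        exact AbsoluteValue.ext fun x => by
          change absv y x = absv y₀ x
          rw [← hw, ← hw', hww']
      · rw [h0 y hr', h2 y hr']
  have hint : ∫ y, (g y - F y) ∂lam = 0 := by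
    rw [integral_sub hg (h.integrable_of_mem_logClosure hF), hi,
      h.integral_eq_zero_of_mem_logClosure hF, sub_zero]
  rw [hd, integral_indicator_const _ (h.measurableSet_resAbs_eq K y₀), smul_eq_mul] at hint
  rcases mul_eq_zero.1 hint with h5 | h5
  · exact (h.measureReal_resAbs_eq_pos K y₀).ne' h5
  · exact hy₀ (sub_eq_zero.1 h5)

end level

section level

variable (h : IsPlaceSpace absv ratPlace lam) [BorelSpace Y] [IsFiniteMeasureOnCompacts lam]
  (K : IntermediateField ℚ (AlgebraicClosure ℚ)) [FiniteDimensional ℚ K]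

include h

theorem mem_centeredClosure_of_arch {g : Y → ℝ} (hg : Integrable g lam)
    (hc : ∀ y y', resAbs absv K y = resAbs absv K y' → g y = g y')
    (h0 : ∀ y, ratPlace y ≠ none → g y = 0) : g ∈ h.centeredClosure := by
  have hi := h.integrable_indicator_fiber none (∫ y, g y ∂lam)
  refine ⟨hg, h.mem_logClosure_of_arch K (hg.sub hi) (fun y y' hyy => ?_) (fun y hy => ?_) ?_⟩
  · simp only [Pi.sub_apply, Set.indicator, Set.mem_ofPred_eq, hc y y' hyy,
      h.ratPlace_eq_of_resAbs hyy]
  · simp [h0 y hy, hy]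
  · simp only [Pi.sub_apply]
    rw [integral_sub hg hi, h.integral_indicator_fiber, sub_self]

theorem indicator_resAbs_mem_centeredClosure (y₀ : Y) :
    ({y | resAbs absv K y = resAbs absv K y₀}.indicator fun _ => (1 : ℝ)) ∈
      h.centeredClosure := by
  have := numberField_of_finiteDimensional K
  rcases hy₀ : ratPlace y₀ with _ | p
  · refine h.mem_centeredClosure_of_arch K (h.integrable_indicator_resAbs K y₀ 1)
      (fun y y' hyy => ?_) (fun y hy => ?_)
    · exact Set.indicator_eq_indicator (by simp [hyy]) rfl
    · refine Set.indicator_of_notMem (fun hyy => hy ?_) _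
      rw [h.ratPlace_eq_of_resAbs hyy, hy₀]
  have : Fact (p : ℕ).Prime := ⟨p.2⟩
  obtain ⟨a, ha0, ha1, ha⟩ := exists_forall_ne_one_imp_eq (h.resAbs_algebraMap K hy₀)
  have ha0' : (a : AlgebraicClosure ℚ) ≠ 0 := by simpa using ha0
  have hf : logAbs absv a ∈ h.centeredClosure := by
    refine ⟨h.integrable_logAbs ha0', ?_⟩
    rw [h.integral_logAbs ha0', Set.indicator_zero, show (fun _ : Y => (0 : ℝ)) = 0 from rfl,
      sub_zero]
    exact h.logAbs_mem_logClosure ha0'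
  have hg : {y | ratPlace y = none}.indicator (logAbs absv a) ∈ h.centeredClosure := by
    refine h.mem_centeredClosure_of_arch K
      ((h.integrable_logAbs ha0').indicator (h.measurableSet_fiber none))
      (fun y y' hyy => ?_) (fun y hy => Set.indicator_of_notMem (by exact hy) _)
    have hyy' : logAbs absv a y = logAbs absv a y' := congrArg Real.log (DFunLike.congr_fun hyy a)
    exact Set.indicator_eq_indicator (by simp [h.ratPlace_eq_of_resAbs hyy]) hyy'
  have hc : logAbs absv a y₀ ≠ 0 := (Real.log_neg ((absv y₀).pos ha0') ha1).ne
  convert h.centeredClosure.smul_mem (logAbs absv a y₀)⁻¹ (sub_mem hf hg) using 1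
  ext y
  simp only [Pi.smul_apply, Pi.sub_apply, smul_eq_mul]
  by_cases hy : resAbs absv K y = resAbs absv K y₀
  · have hyn : ratPlace y ≠ none := by simp [h.ratPlace_eq_of_resAbs hy, hy₀]
    have hyy : logAbs absv a y = logAbs absv a y₀ := congrArg Real.log (DFunLike.congr_fun hy a)
    rw [Set.indicator_of_mem (by exact hy), Set.indicator_of_notMem (by exact hyn), sub_zero, hyy,
      inv_mul_cancel₀ hc]
  · rw [Set.indicator_of_notMem (by exact hy)]
    rcases hyr : ratPlace y with _ | p'
    · rw [Set.indicator_of_mem (by exact hyr), sub_self, mul_zero]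
    · have : Fact (p' : ℕ).Prime := ⟨p'.2⟩
      have h1 : absv y a = 1 := by
        by_contra hne
        exact hy (ha p' (resAbs absv K y) (h.resAbs_algebraMap K hyr) hne)
      have h2 : logAbs absv a y = 0 := by rw [logAbs, h1, Real.log_one]
      rw [Set.indicator_of_notMem (by simp [hyr]), h2, sub_zero, mul_zero]

theorem indicator_mem_centeredClosure {g : Y → ℝ}
    (hc : ∀ y y', resAbs absv K y = resAbs absv K y' → g y = g y')
    {T : Set (AbsoluteValue K ℝ)} (hT : T.Finite) :
    {y | resAbs absv K y ∈ T}.indicator g ∈ h.centeredClosure := by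
  induction T, hT using Set.Finite.induction_on with
  | empty =>
    convert h.centeredClosure.zero_mem using 1
    ext y
    simp
  | @insert a T ha _ ih =>
    have hsum : {y | resAbs absv K y ∈ insert a T}.indicator g =
        {y | resAbs absv K y = a}.indicator g + {y | resAbs absv K y ∈ T}.indicator g := by
      have hd : Disjoint {y | resAbs absv K y = a} {y | resAbs absv K y ∈ T} :=
        Set.disjoint_left.2 fun y (hy : _ = a) (hy' : _ ∈ T) => ha (hy ▸ hy')
      exact Set.indicator_union_of_disjoint hd g
    rw [hsum]
    refine add_mem ?_ ih
    by_cases hex : ∃ y₀, resAbs absv K y₀ = a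
    · obtain ⟨y₀, rfl⟩ := hex
      convert h.centeredClosure.smul_mem (g y₀) (h.indicator_resAbs_mem_centeredClosure K y₀)
        using 1
      ext y
      by_cases hy : resAbs absv K y = resAbs absv K y₀
      · simp [Set.indicator, hy, hc y y₀ hy]
      · simp [Set.indicator, hy]
    · have : {y | resAbs absv K y = a} = ∅ :=
        Set.eq_empty_of_forall_notMem fun y hy => hex ⟨y, hy⟩
      rw [this, Set.indicator_empty]
      exact zero_mem _

theorem mem_centeredClosure_of_level {g : Y → ℝ}
    (hc : ∀ y y', resAbs absv K y = resAbs absv K y' → g y = g y')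
    (S : Finset (Option Nat.Primes)) :
    {y | ratPlace y ∈ S}.indicator g ∈ h.centeredClosure := by
  have hT : (⋃ v ∈ S, resAbs absv K '' {y | ratPlace y = v}).Finite :=
    S.finite_toSet.biUnion fun v _ => h.finite_resAbs K v
  convert h.indicator_mem_centeredClosure K hc hT using 2
  ext y
  simp only [Set.mem_ofPred_eq, Set.mem_iUnion, Set.mem_image, exists_prop]
  constructor
  · exact fun hy => ⟨_, hy, y, rfl, rfl⟩
  · rintro ⟨v, hv, y', rfl, hyy⟩
    rwa [← h.ratPlace_eq_of_resAbs hyy]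

end level

section density

variable (h : IsPlaceSpace absv ratPlace lam)

/-- The algebra of continuous functions on the space of places that come from a finite level. -/
def levelSubalgebra (absv : Y → AbsoluteValue (AlgebraicClosure ℚ) ℝ) : Subalgebra ℝ C(Y, ℝ) where
  carrier := {g | ∃ K : IntermediateField ℚ (AlgebraicClosure ℚ), FiniteDimensional ℚ K ∧
    ∀ y y', resAbs absv K y = resAbs absv K y' → g y = g y'}
  algebraMap_mem' r := ⟨⊥, inferInstance, fun y y' _ => rfl⟩
  add_mem' := by
    rintro f g ⟨K, hK, hf⟩ ⟨L, hL, hg⟩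
    refine ⟨K ⊔ L, inferInstance, fun y y' hyy => ?_⟩
    rw [ContinuousMap.add_apply, ContinuousMap.add_apply,
      hf y y' (resAbs_eq_of_le le_sup_left hyy), hg y y' (resAbs_eq_of_le le_sup_right hyy)]
  mul_mem' := by
    rintro f g ⟨K, hK, hf⟩ ⟨L, hL, hg⟩
    refine ⟨K ⊔ L, inferInstance, fun y y' hyy => ?_⟩
    rw [ContinuousMap.mul_apply, ContinuousMap.mul_apply,
      hf y y' (resAbs_eq_of_le le_sup_left hyy), hg y y' (resAbs_eq_of_le le_sup_right hyy)]

include h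

theorem separatesPoints_levelSubalgebra : (levelSubalgebra absv).SeparatesPoints := by
  intro y y' hne
  obtain ⟨x, hx⟩ : ∃ x, absv y x ≠ absv y' x := by
    by_contra! hx
    exact hne (h.sep y y' hx)
  refine ⟨_, ⟨⟨fun y => absv y x, h.continuous_absv x⟩, ⟨IntermediateField.adjoin ℚ {x},
    IntermediateField.adjoin.finiteDimensional (Algebra.IsAlgebraic.isAlgebraic x).isIntegral,
    fun y y' hyy => ?_⟩, rfl⟩, hx⟩
  exact DFunLike.congr_fun hyy (IntermediateField.AdjoinSimple.gen ℚ x)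

variable [BorelSpace Y] [IsFiniteMeasureOnCompacts lam]

theorem mem_centeredClosure_of_hasCompactSupport {g : Y → ℝ} (hg : Continuous g)
    (hs : HasCompactSupport g) : g ∈ h.centeredClosure := by
  refine h.mem_centeredClosure_of_forall (hg.integrable_of_hasCompactSupport hs) fun ε hε => ?_
  obtain ⟨S, hS⟩ := hs.elim_finite_subcover (fun v => {y | ratPlace y = v}) h.isOpen_fiber
    fun y _ => Set.mem_iUnion.2 ⟨ratPlace y, rfl⟩
  have hU : {y | ratPlace y ∈ S} = ⋃ v ∈ S, {y | ratPlace y = v} := by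
    ext y
    simp
  have hcomp : IsCompact {y | ratPlace y ∈ S} := by
    rw [hU]
    exact S.isCompact_biUnion fun v _ => h.isCompact_fiber v
  have hmeas : MeasurableSet {y | ratPlace y ∈ S} := by
    rw [hU]
    exact S.measurableSet_biUnion fun v _ => h.measurableSet_fiber v
  set m := lam.real {y | ratPlace y ∈ S} with hm
  have hm0 : 0 ≤ m := measureReal_nonneg
  obtain ⟨f, ⟨K, hK, hf⟩, hfg⟩ :=
    ContinuousMap.exists_mem_subalgebra_near_continuous_of_isCompact_of_separatesPoints
      h.separatesPoints_levelSubalgebra ⟨g, hg⟩ hcomp (ε := ε / (m + 1)) (by positivity)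
  refine ⟨_, h.mem_centeredClosure_of_level K hf S, ?_⟩
  have hle : ∫ y, |g y - {y | ratPlace y ∈ S}.indicator f y| ∂lam ≤
      ∫ y, {y | ratPlace y ∈ S}.indicator (fun _ => ε / (m + 1)) y ∂lam := by
    refine integral_mono_of_nonneg (.of_forall fun y => abs_nonneg _)
      ((integrable_indicator_iff hmeas).2 (integrableOn_const hcomp.measure_lt_top.ne))
      (.of_forall fun y => ?_)
    by_cases hy : y ∈ {y | ratPlace y ∈ S}
    · have h1 := hfg y hy
      simp only [Set.indicator_of_mem hy]
      rw [abs_sub_comm]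
      exact h1.le
    · simp only [Set.indicator_of_notMem hy]
      have : g y = 0 := by
        by_contra hne
        refine hy ?_
        rw [hU]
        exact hS (subset_tsupport g hne)
      simp [this]
  refine hle.trans ?_
  rw [integral_indicator_const _ hmeas, ← hm, smul_eq_mul, mul_div_assoc',
    div_le_iff₀ (by positivity)]
  nlinarith

end density

section final

variable (h : IsPlaceSpace absv ratPlace lam) [BorelSpace Y] [T2Space Y] [LocallyCompactSpace Y]
  [lam.Regular]

include h

theorem mem_centeredClosure {F : Y → ℝ} (hF : Integrable F lam) : F ∈ h.centeredClosure := by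
  have : SigmaCompactSpace Y := SigmaCompactSpace.of_countable
    (Set.range fun v : Option Nat.Primes => {y | ratPlace y = v}) (Set.countable_range _)
    (by rintro _ ⟨v, rfl⟩; exact h.isCompact_fiber v)
    (Set.eq_univ_of_forall fun y => ⟨_, ⟨ratPlace y, rfl⟩, rfl⟩)
  refine h.mem_centeredClosure_of_forall hF fun ε hε => ?_
  obtain ⟨g, hs, hle, hg, -⟩ := hF.exists_hasCompactSupport_integral_sub_le hε
  exact ⟨g, h.mem_centeredClosure_of_hasCompactSupport hg hs, hle⟩

theorem mem_logClosure {F : Y → ℝ} (hF : Integrable F lam) (hF0 : ∫ y, F y ∂lam = 0) :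
    F ∈ h.logClosure := by
  have h1 := (h.mem_centeredClosure hF).2
  rwa [hF0, Set.indicator_zero, show (fun _ : Y => (0 : ℝ)) = 0 from rfl, sub_zero] at h1

end final

end IsPlaceSpace

end

/-- Let `Y` be the space of all places of the algebraic closure `Q̄` of
`ℚ` with its natural totally disconnected, locally compact, Hausdorff topology
(a point `y` of `Y` is described by the absolute value `‖·‖_y = absv y` in the place `y`
normalized so that its restriction to `ℚ` is the usual archimedean absolute value or a
`p`-adic absolute value, according to the place `ratPlace y` of `ℚ` that `y` lies over;
distinct points of `Y` are distinct places, every absolute value of `Q̄` extending a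
standard absolute value of `ℚ` occurs, each fiber `Y(ℚ,v)` over a place `v` of `ℚ` is
compact and open, the absolute Galois group `G = Aut(Q̄/ℚ)` with its Krull topology acts
continuously on `Y` by `‖α‖_{τ•y} = ‖τ⁻¹α‖_y`, transitively on each fiber, and each
function `f_α(y) = log ‖α‖_y` for `α ∈ Q̄ˣ` is continuous with compact support).
Let `λ` be the `G`-invariant regular Borel measure on `Y` with `λ(Y(ℚ,v)) = 1` for every
place `v` of `ℚ`, and let `𝔛 = {F ∈ L¹(Y, λ) : ∫_Y F dλ = 0}`.
Then `𝔉 = {f_α : α ∈ Q̄ˣ}` is dense in `𝔛` with respect to the `L¹`-norm. -/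
theorem weilHeight_image_dense_in_L1
    (Y : Type*) [TopologicalSpace Y] [LocallyCompactSpace Y] [T2Space Y]
    [TotallyDisconnectedSpace Y] [MeasurableSpace Y] [BorelSpace Y]
    (absv : Y → AbsoluteValue (AlgebraicClosure ℚ) ℝ)
    (ratPlace : Y → Option Nat.Primes)
    (hArch : ∀ y, ratPlace y = none →
      ∀ q : ℚ, absv y (algebraMap ℚ (AlgebraicClosure ℚ) q) = |(q : ℝ)|)
    (hPadic : ∀ y (p : Nat.Primes), ratPlace y = some p →
      ∀ q : ℚ, absv y (algebraMap ℚ (AlgebraicClosure ℚ) q) = (padicNorm p q : ℝ))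
    (hSep : ∀ y y', (∀ x, absv y x = absv y' x) → y = y')
    (hAllArch : ∀ w : AbsoluteValue (AlgebraicClosure ℚ) ℝ,
      (∀ q : ℚ, w (algebraMap ℚ (AlgebraicClosure ℚ) q) = |(q : ℝ)|) →
      ∃ y, ∀ x, absv y x = w x)
    (hAllPadic : ∀ (p : Nat.Primes) (w : AbsoluteValue (AlgebraicClosure ℚ) ℝ),
      (∀ q : ℚ, w (algebraMap ℚ (AlgebraicClosure ℚ) q) = (padicNorm p q : ℝ)) →
      ∃ y, ∀ x, absv y x = w x)
    (hFiberCompact : ∀ v : Option Nat.Primes, IsCompact {y | ratPlace y = v})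
    (hFiberOpen : ∀ v : Option Nat.Primes, IsOpen {y | ratPlace y = v})
    [MulAction (AlgebraicClosure ℚ ≃ₐ[ℚ] AlgebraicClosure ℚ) Y]
    [ContinuousSMul (AlgebraicClosure ℚ ≃ₐ[ℚ] AlgebraicClosure ℚ) Y]
    (hGal : ∀ (τ : AlgebraicClosure ℚ ≃ₐ[ℚ] AlgebraicClosure ℚ) (y : Y)
      (x : AlgebraicClosure ℚ), absv (τ • y) x = absv y (τ⁻¹ x))
    (hTrans : ∀ y y' : Y, ratPlace y = ratPlace y' →
      ∃ τ : AlgebraicClosure ℚ ≃ₐ[ℚ] AlgebraicClosure ℚ, τ • y = y')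
    (hCont : ∀ α : (AlgebraicClosure ℚ)ˣ,
      Continuous fun y : Y => Real.log (absv y (α : AlgebraicClosure ℚ)))
    (hSupp : ∀ α : (AlgebraicClosure ℚ)ˣ,
      HasCompactSupport fun y : Y => Real.log (absv y (α : AlgebraicClosure ℚ)))
    (lam : Measure Y) [lam.Regular]
    (hInv : ∀ τ : AlgebraicClosure ℚ ≃ₐ[ℚ] AlgebraicClosure ℚ,
      Measure.map (fun y : Y => τ • y) lam = lam)
    (hFiberMass : ∀ v : Option Nat.Primes, lam {y | ratPlace y = v} = 1) :
    ∀ F : Y → ℝ, Integrable F lam → ∫ y, F y ∂lam = 0 →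
      ∀ ε : ℝ, 0 < ε → ∃ α : (AlgebraicClosure ℚ)ˣ,
        ∫ y, |F y - Real.log (absv y (α : AlgebraicClosure ℚ))| ∂lam < ε := by
  have h : IsPlaceSpace absv ratPlace lam :=
    { arch := hArch
      padic := hPadic
      sep := hSep
      exists_arch := hAllArch
      isCompact_fiber := hFiberCompact
      isOpen_fiber := hFiberOpen
      absv_smul := hGal
      exists_smul_eq := hTrans
      continuous_smul := fun τ => continuous_const_smul τ
      continuous_logAbs := hCont
      hasCompactSupport_logAbs := hSupp
      map_smul := hInv
      measure_fiber := hFiberMass }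
  intro F hF hF0
  exact (h.mem_logClosure hF hF0).2
end

section
/- With Y and 𝔉 = {f_α : α ∈ Q̄ˣ} (f_α(y) = log‖α‖_y) as described, the set 𝔉 is dense in C₀(Y), the Banach space of continuous real-valued functions on Y vanishing at infinity equipped with the supremum norm. -/
open MeasureTheory

/-- A finite-dimensional normed field over `ℝ` embeds isometrically into `ℂ`. -/
theorem norm_algHom_eq_norm {F : Type*} [NormedField F] [NormedAlgebra ℝ F]
    [FiniteDimensional ℝ F] (σ : F →ₐ[ℝ] ℂ) (x : F) : ‖σ x‖ = ‖x‖ := by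
  have key : ∀ x : F, ‖σ x‖ ≤ ‖x‖ := by
    intro x
    by_contra! hlt
    have hx : 0 < ‖x‖ := norm_pos_iff.2 (by rintro rfl; simp at hlt)
    let T := σ.toLinearMap.toContinuousLinearMap
    obtain ⟨n, hn⟩ := pow_unbounded_of_one_lt ‖T‖ ((one_lt_div hx).2 hlt)
    have h := T.le_opNorm (x ^ n)
    have hT : T (x ^ n) = σ x ^ n := map_pow σ x n
    rw [hT, norm_pow, norm_pow] at h
    rw [div_pow, lt_div_iff₀ (by positivity)] at hn
    exact absurd h hn.not_ge
  refine le_antisymm (key x) ?_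
  rcases eq_or_ne x 0 with rfl | hx
  · simp
  · have h := key x⁻¹
    rw [map_inv₀, norm_inv, norm_inv] at h
    exact (inv_le_inv₀ (norm_pos_iff.2 (by simpa using hx)) (norm_pos_iff.2 hx)).1 h

/-- **Ostrowski's theorem**, archimedean case: an absolute value which restricts to the usual
one on `ℚ` is an infinite place. -/
theorem exists_infinitePlace_of_forall_rat {L : Type*} [Field L] [CharZero L]
    (v : AbsoluteValue L ℝ) (hv : ∀ q : ℚ, v q = |(q : ℝ)|) :
    ∃ w : NumberField.InfinitePlace L, ∀ x, w x = v x := by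
  let j : L →+* v.Completion :=
    (UniformSpace.Completion.coeRingHom (α := WithAbs v)).comp (WithAbs.equiv v).symm.toRingHom
  have hj : ∀ x, ‖j x‖ = v x := fun x => UniformSpace.Completion.norm_coe _
  let i : ℚ →+* v.Completion := j.comp (Rat.castHom L)
  have hi : ∀ q, ‖i q‖ = ‖q‖ := fun q => by
    rw [RingHom.comp_apply, hj, eq_ratCast, hv, ← Real.norm_eq_abs, Rat.norm_cast_real]
  have hiso : Isometry i := AddMonoidHomClass.isometry_of_norm i hi
  have hdi : IsDenseInducing (Rat.castHom ℝ) := Rat.isDenseEmbedding_coe_real.isDenseInducing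
  let φ : ℝ →+* v.Completion := IsDenseInducing.extendRingHom (i := Rat.castHom ℝ)
    Rat.isUniformEmbedding_coe_real.isUniformInducing hdi.dense hiso.uniformContinuous
  have hφc : Continuous φ := (uniformContinuous_uniformly_extend
    Rat.isUniformEmbedding_coe_real.isUniformInducing hdi.dense hiso.uniformContinuous).continuous
  have hφ : ∀ r, ‖φ r‖ = ‖r‖ := by
    refine fun r => congrFun (hdi.dense.equalizer hφc.norm continuous_norm (funext fun q => ?_)) r
    have : φ (Rat.castHom ℝ q) = i q := hdi.extend_eq hiso.continuous q
    rw [Function.comp_apply, Function.comp_apply, this, hi, eq_ratCast, Rat.norm_cast_real]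
  let _ : NormedAlgebra ℝ v.Completion :=
    { φ.toAlgebra with
      norm_smul_le := fun r x => by
        change ‖φ r * x‖ ≤ _
        rw [norm_mul, hφ] }
  obtain ⟨σ, hfd⟩ : ∃ σ : v.Completion →ₐ[ℝ] ℂ, FiniteDimensional ℝ v.Completion := by
    rcases NormedAlgebra.Real.nonempty_algEquiv_or v.Completion with ⟨⟨e⟩⟩ | ⟨⟨e⟩⟩
    · exact ⟨(Algebra.ofId ℝ ℂ).comp e.toAlgHom, e.symm.toLinearEquiv.finiteDimensional⟩
    · exact ⟨e.toAlgHom, e.symm.toLinearEquiv.finiteDimensional⟩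
  refine ⟨NumberField.InfinitePlace.mk (σ.toRingHom.comp j), fun x => ?_⟩
  rw [NumberField.InfinitePlace.apply, ← hj x, ← norm_algHom_eq_norm σ]
  rfl

theorem AbsoluteValue.isNonarchimedean_of_natCast_le_one {K : Type*} [Field K]
    {v : AbsoluteValue K ℝ} (hv : ∀ n : ℕ, v n ≤ 1) : IsNonarchimedean v := by
  have : IsUltrametricDist (WithAbs v) :=
    IsUltrametricDist.isUltrametricDist_of_forall_norm_natCast_le_one hv
  exact fun x y => IsUltrametricDist.norm_add_le_max (WithAbs.toAbs v x) (WithAbs.toAbs v y)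

theorem AbsoluteValue.le_one_of_isIntegral {K : Type*} [Field K]
    {v : AbsoluteValue K ℝ} (hv : ∀ n : ℕ, v n ≤ 1) {x : K} (hx : IsIntegral ℤ x) : v x ≤ 1 := by
  have : IsUltrametricDist (WithAbs v) :=
    IsUltrametricDist.isUltrametricDist_of_forall_norm_natCast_le_one hv
  have hx' : IsIntegral ℤ (WithAbs.toAbs v x) :=
    map_isIntegral_int (WithAbs.equiv v).symm.toRingHom hx
  exact (Valuation.integer.integers (NormedField.valuation (K := WithAbs v))).mem_of_integral
    hx'.tower_top

/-- The functions `Y → ℝ` that are uniform limits of functions `y ↦ log ‖α‖_y`. For an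
algebraically closed field these functions form a real vector space as soon as every
`y ↦ log ‖α‖_y` is bounded. -/
def logClosure {Y K : Type*} [Field K] [IsAlgClosed K] (absv : Y → AbsoluteValue K ℝ)
    (hb : ∀ α : Kˣ, ∃ M : ℝ, ∀ y, |Real.log (absv y α)| ≤ M) : Submodule ℝ (Y → ℝ) where
  carrier := {g | ∀ ε : ℝ, 0 < ε → ∃ α : Kˣ, ∀ y, |g y - Real.log (absv y α)| < ε}
  zero_mem' ε hε := ⟨1, fun y => by simpa using hε⟩
  add_mem' {f g} hf hg ε hε := by
    obtain ⟨α, hα⟩ := hf (ε / 2) (by positivity)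
    obtain ⟨β, hβ⟩ := hg (ε / 2) (by positivity)
    refine ⟨α * β, fun y => ?_⟩
    have h1 := hα y
    have h2 := hβ y
    rw [Units.val_mul, map_mul, Real.log_mul (by simp) (by simp), Pi.add_apply]
    rw [abs_lt] at *
    constructor <;> linarith
  smul_mem' c g hg ε hε := by
    obtain ⟨α, hα⟩ := hg (ε / 2 / (|c| + 1)) (by positivity)
    obtain ⟨M, hM⟩ := hb α
    obtain ⟨r, hr1, hr2⟩ := exists_rat_btwn (show c < c + ε / 2 / (|M| + 1) by
      linarith [show 0 < ε / 2 / (|M| + 1) by positivity])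
    obtain ⟨β, hβ⟩ := IsAlgClosed.exists_pow_nat_eq (α : K) r.pos
    have hβ0 : β ≠ 0 := by
      rintro rfl
      exact α.ne_zero (by rw [← hβ, zero_pow r.pos.ne'])
    refine ⟨Units.mk0 β hβ0 ^ r.num, fun y => ?_⟩
    have hlog : Real.log (absv y ↑(Units.mk0 β hβ0 ^ r.num)) = r * Real.log (absv y α) := by
      have hd : (r.den : ℝ) ≠ 0 := by exact_mod_cast r.pos.ne'
      rw [Units.val_zpow_eq_zpow_val, Units.val_mk0, map_zpow₀, Real.log_zpow, ← hβ, map_pow,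
        Real.log_pow, Rat.cast_def]
      field_simp
    rw [hlog, Pi.smul_apply, smul_eq_mul]
    have e1 : |c * (g y - Real.log (absv y α))| ≤ |c| * (ε / 2 / (|c| + 1)) := by
      rw [abs_mul]
      exact mul_le_mul_of_nonneg_left (hα y).le (abs_nonneg c)
    have e2 : |c| * (ε / 2 / (|c| + 1)) < ε / 2 := by
      rw [← mul_div_assoc, div_lt_iff₀ (by positivity)]
      nlinarith [abs_nonneg c]
    have e3 : |(c - r) * Real.log (absv y α)| ≤ ε / 2 / (|M| + 1) * |M| := by
      rw [abs_mul]
      refine mul_le_mul ?_ ((hM y).trans (le_abs_self M)) (abs_nonneg _) (by positivity)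
      rw [abs_le]
      constructor <;> linarith [show 0 < ε / 2 / (|M| + 1) by positivity]
    have e4 : ε / 2 / (|M| + 1) * |M| ≤ ε / 2 := by
      rw [div_mul_eq_mul_div, div_le_iff₀ (by positivity)]
      nlinarith [abs_nonneg M]
    calc |c * g y - r * Real.log (absv y α)|
        = |c * (g y - Real.log (absv y α)) + (c - r) * Real.log (absv y α)| := by ring_nf
      _ ≤ _ := abs_add_le _ _
      _ < ε := by linarith

theorem exists_pow_eq_mul_of_pow_eq_span {R : Type*} [CommRing R] [IsDedekindDomain R]
    {P : Ideal R} (hP : P.IsPrime) (hP0 : P ≠ ⊥) {n : ℕ} {a : R} (ha : P ^ n = Ideal.span {a})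
    {b : R} (hb : b ≠ 0) :
    ∃ k : ℕ, ∃ z ∉ P, b ^ n = a ^ k * z ∧ (b ∈ P → k ≠ 0) := by
  have hprime : Prime P := Ideal.prime_of_isPrime hP0 hP
  have hb' : Ideal.span {b} ≠ 0 := by simpa using hb
  obtain ⟨J, hJ, hPJ⟩ :=
    (FiniteMultiplicity.of_not_isUnit hprime.not_isUnit hb').exists_eq_pow_mul_and_not_dvd
  set k := multiplicity P (Ideal.span {b})
  have hspan : Ideal.span {b ^ n} = Ideal.span {a ^ k} * J ^ n := by
    rw [← Ideal.span_singleton_pow, hJ, mul_pow, ← pow_mul, mul_comm k n, pow_mul, ha,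
      Ideal.span_singleton_pow]
  obtain ⟨z, hz, hbz⟩ := Ideal.mem_span_singleton_mul.1 (hspan ▸ Ideal.mem_span_singleton_self _)
  refine ⟨k, z, fun hzP => hPJ ?_, hbz.symm, fun hbP hk => ?_⟩
  · rw [← hbz, ← Ideal.span_singleton_mul_span_singleton] at hspan
    have ha0 : Ideal.span {a ^ k} ≠ 0 := by
      rw [← Ideal.span_singleton_pow, ← ha]
      exact pow_ne_zero _ (pow_ne_zero _ hP0)
    exact hprime.dvd_of_dvd_pow
      (mul_left_cancel₀ ha0 hspan ▸ Ideal.dvd_span_singleton.2 hzP)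
  · rw [hk, pow_zero, one_mul] at hJ
    exact hPJ (hJ ▸ Ideal.dvd_span_singleton.2 hbP)

theorem exists_pow_eq_span_singleton_s2 {R : Type*} [CommRing R] [IsDedekindDomain R]
    [Finite (ClassGroup R)] {I : Ideal R} (hI : I ≠ ⊥) :
    ∃ n ≠ 0, ∃ a : R, I ^ n = Ideal.span {a} := by
  have hI' := mem_nonZeroDivisors_of_ne_zero hI
  refine ⟨Nat.card (ClassGroup R), Nat.card_pos.ne', ?_⟩
  have h : ClassGroup.mk0 ⟨I ^ Nat.card (ClassGroup R), pow_mem hI' _⟩ = 1 := by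
    rw [← pow_card_eq_one' (x := ClassGroup.mk0 ⟨I, hI'⟩), ← map_pow]
    rfl
  exact ((ClassGroup.mk0_eq_one_iff _).1 h).principal

section LogClosure

open NumberField

/-- The ideal `P` is the center of the place `y` on the ring of integers of a field `L`. -/
def IsCenter {Y K L : Type*} [Field K] [Field L] (absv : Y → AbsoluteValue K ℝ) (i : L →+* K)
    (y : Y) (P : Ideal (𝓞 L)) : Prop :=
  ∀ x : 𝓞 L, x ∈ P ↔ absv y (i x) < 1

variable {Y K : Type*} [Field K] {absv : Y → AbsoluteValue K ℝ}
  {ratPlace : Y → Option Nat.Primes}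

/-- The absolute values `absv y` extend the standard absolute value of `ℚ` named by
`ratPlace y`. -/
structure ExtendsRat (absv : Y → AbsoluteValue K ℝ) (ratPlace : Y → Option Nat.Primes) :
    Prop where
  arch : ∀ y, ratPlace y = none → ∀ q : ℚ, absv y q = |(q : ℝ)|
  padic : ∀ y (p : Nat.Primes), ratPlace y = some p → ∀ q : ℚ, absv y q = (padicNorm p q : ℝ)

theorem ExtendsRat.natCast_le_one (h : ExtendsRat absv ratPlace) {y : Y} {p : Nat.Primes}
    (hy : ratPlace y = some p) (n : ℕ) : absv y n ≤ 1 := by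
  have : Fact (p : ℕ).Prime := ⟨p.2⟩
  have e := h.padic y p hy n
  rw [Rat.cast_natCast] at e
  rw [e]
  exact_mod_cast padicNorm.of_nat n

theorem ExtendsRat.le_one (h : ExtendsRat absv ratPlace) {y : Y} {p : Nat.Primes}
    (hy : ratPlace y = some p) {L : Type*} [Field L] (i : L →+* K) (x : 𝓞 L) :
    absv y (i x) ≤ 1 :=
  AbsoluteValue.le_one_of_isIntegral (h.natCast_le_one hy) (map_isIntegral_int i x.isIntegral_coe)

theorem ExtendsRat.eq_one_of_isUnit (h : ExtendsRat absv ratPlace) {y : Y} {p : Nat.Primes}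
    (hy : ratPlace y = some p) {L : Type*} [Field L] (i : L →+* K) {x : 𝓞 L} (hx : IsUnit x) :
    absv y (i x) = 1 := by
  obtain ⟨z, hxz⟩ := hx.exists_right_inv
  have e : absv y (i x) * absv y (i z) = 1 := by
    rw [← map_mul, ← map_mul, ← map_mul, hxz]
    simp
  have h1 := h.le_one hy i x
  have h2 := h.le_one hy i z
  nlinarith [(absv y).nonneg (i x), (absv y).nonneg (i z)]

theorem exists_isCenter (h : ExtendsRat absv ratPlace) {y : Y} {p : Nat.Primes}
    (hy : ratPlace y = some p) {L : Type*} [Field L] (i : L →+* K) :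
    ∃ P : Ideal (𝓞 L), P.IsPrime ∧ IsCenter absv i y P := by
  have hna := AbsoluteValue.isNonarchimedean_of_natCast_le_one (h.natCast_le_one hy)
  let P : Ideal (𝓞 L) :=
    { carrier := {x | absv y (i x) < 1}
      zero_mem' := by simp
      add_mem' := fun {x z} hx hz => by
        have e := hna (i x) (i z)
        rw [← map_add, ← map_add] at e
        exact e.trans_lt (max_lt hx hz)
      smul_mem' := fun x z hz => by
        change absv y (i ((x * z : 𝓞 L) : L)) < 1
        simp only [map_mul]
        exact mul_lt_one_of_nonneg_of_lt_one_right (h.le_one hy i x) ((absv y).nonneg _) hz }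
  refine ⟨P, ⟨fun htop => ?_, fun {x z} hxz => ?_⟩, fun x => Iff.rfl⟩
  · have h1 : (1 : 𝓞 L) ∈ P := htop ▸ trivial
    have h2 : absv y (i (1 : 𝓞 L)) < 1 := h1
    simp at h2
  · by_contra! hcon
    have h1 : absv y (i x) = 1 := le_antisymm (h.le_one hy i x) (not_lt.1 hcon.1)
    have h2 : absv y (i z) = 1 := le_antisymm (h.le_one hy i z) (not_lt.1 hcon.2)
    have h3 : absv y (i ((x * z : 𝓞 L) : L)) < 1 := hxz
    simp [h1, h2] at h3

theorem IsCenter.eq_one (h : ExtendsRat absv ratPlace) {y : Y} {p : Nat.Primes}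
    (hy : ratPlace y = some p) {L : Type*} [Field L] {i : L →+* K} {P : Ideal (𝓞 L)}
    (hP : IsCenter absv i y P) {x : 𝓞 L} (hx : x ∉ P) : absv y (i x) = 1 :=
  le_antisymm (h.le_one hy i x) (not_lt.1 (mt (hP x).2 hx))

theorem IsCenter.natCast_mem [CharZero K] (h : ExtendsRat absv ratPlace) {y : Y} {p : Nat.Primes}
    (hy : ratPlace y = some p) {L : Type*} [Field L] {i : L →+* K} {P : Ideal (𝓞 L)}
    (hP : IsCenter absv i y P) : ((p : ℕ) : 𝓞 L) ∈ P := by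
  have : Fact (p : ℕ).Prime := ⟨p.2⟩
  have e := h.padic y p hy (p : ℕ)
  rw [padicNorm.padicNorm_p_of_prime, Rat.cast_natCast] at e
  have := p.2.one_lt
  rw [hP]
  simp only [map_natCast, e]
  push_cast
  exact inv_lt_one_of_one_lt₀ (by exact_mod_cast this)

theorem IsCenter.prime_eq [CharZero K] (h : ExtendsRat absv ratPlace) {y y' : Y} {p p' : Nat.Primes}
    (hy : ratPlace y = some p) (hy' : ratPlace y' = some p')
    {L : Type*} [Field L] {i : L →+* K} {P : Ideal (𝓞 L)} (hP : IsCenter absv i y P)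
    (hPp : P.IsPrime) (hP' : IsCenter absv i y' P) : p = p' := by
  by_contra hne
  have : ((p : ℕ)).Coprime p' := (Nat.coprime_primes p.2 p'.2).2 fun e => hne (Subtype.ext e)
  refine hPp.ne_top ((Ideal.eq_top_iff_one P).2 ?_)
  obtain ⟨u, v, huv⟩ := (Nat.isCoprime_iff_coprime.2 this).map (Int.castRingHom (𝓞 L))
  rw [← huv]
  exact P.add_mem (P.mul_mem_left _ (by simpa using hP.natCast_mem h hy))
    (P.mul_mem_left _ (by simpa using hP'.natCast_mem h hy'))

/-- A `p`-adic place is determined on a number field by its center. -/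
theorem IsCenter.absv_eq [CharZero K] (h : ExtendsRat absv ratPlace) {y y' : Y} {p p' : Nat.Primes}
    (hy : ratPlace y = some p) (hy' : ratPlace y' = some p')
    {L : Type*} [Field L] [NumberField L] {i : L →+* K} {P : Ideal (𝓞 L)} (hPp : P.IsPrime)
    (hP : IsCenter absv i y P) (hP' : IsCenter absv i y' P) (x : L) :
    absv y (i x) = absv y' (i x) := by
  have hp0 : ((p : ℕ) : 𝓞 L) ≠ 0 := by exact_mod_cast p.2.ne_zero
  have hPbot : P ≠ ⊥ := by
    rintro rfl
    exact hp0 (hP.natCast_mem h hy)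
  obtain rfl : p = p' := hP.prime_eq h hy hy' hPp hP'
  obtain ⟨n, hn, a, ha⟩ := exists_pow_eq_span_singleton_s2 hPbot
  have hpow : ∀ z : Y, ratPlace z = some p → IsCenter absv i z P → ∀ (b c : 𝓞 L) (k : ℕ), c ∉ P →
      b ^ n = a ^ k * c → absv z (i b) ^ n = absv z (i a) ^ k := by
    intro z hz hPz b c k hc hb
    rw [← map_pow, ← map_pow, ← map_pow, hb, map_mul, map_mul, map_mul, hPz.eq_one h hz hc,
      mul_one, map_pow, map_pow, map_pow]
  have hvala : absv y (i a) = absv y' (i a) := by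
    obtain ⟨k, c, hc, hpc, hk⟩ := exists_pow_eq_mul_of_pow_eq_span hPp hPbot ha hp0
    refine (pow_left_inj₀ ((absv y).nonneg _) ((absv y').nonneg _) (hk (hP.natCast_mem h hy))).1 ?_
    rw [← hpow y hy hP _ c k hc hpc, ← hpow y' hy' hP' _ c k hc hpc]
    have e := h.padic y p hy (p : ℕ)
    have e' := h.padic y' p hy' (p : ℕ)
    rw [Rat.cast_natCast] at e e'
    simp only [map_natCast, e, e']
  have hring : ∀ b : 𝓞 L, absv y (i b) = absv y' (i b) := by
    intro b
    rcases eq_or_ne b 0 with rfl | hb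
    · simp
    obtain ⟨k, c, hc, hbc, -⟩ := exists_pow_eq_mul_of_pow_eq_span hPp hPbot ha hb
    refine (pow_left_inj₀ ((absv y).nonneg _) ((absv y').nonneg _) hn).1 ?_
    rw [hpow y hy hP b c k hc hbc, hpow y' hy' hP' b c k hc hbc, hvala]
  obtain ⟨b, c, -, rfl⟩ := IsFractionRing.div_surjective (A := 𝓞 L) x
  rw [map_div₀, map_div₀, map_div₀, hring, hring]

/-- The continuous functions on `X` which only depend on the restriction of an absolute value to
some finite extension of `ℚ`. -/
def finiteLevelSubalgebra [CharZero K] {X : Type*} [TopologicalSpace X]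
    (absv : X → AbsoluteValue K ℝ) :
    Subalgebra ℝ C(X, ℝ) where
  carrier := {g | ∃ E : IntermediateField ℚ K, FiniteDimensional ℚ E ∧
    ∀ y y', (∀ x ∈ E, absv y x = absv y' x) → g y = g y'}
  algebraMap_mem' _ := ⟨⊥, inferInstance, fun _ _ _ => rfl⟩
  add_mem' := by
    rintro f g ⟨E, hE, hf⟩ ⟨E', hE', hg⟩
    refine ⟨E ⊔ E', IntermediateField.finiteDimensional_sup E E', fun y y' hyy' => ?_⟩
    rw [ContinuousMap.add_apply, ContinuousMap.add_apply,
      hf y y' fun x hx => hyy' x (le_sup_left (a := E) hx),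
      hg y y' fun x hx => hyy' x (le_sup_right (a := E) hx)]
  mul_mem' := by
    rintro f g ⟨E, hE, hf⟩ ⟨E', hE', hg⟩
    refine ⟨E ⊔ E', IntermediateField.finiteDimensional_sup E E', fun y y' hyy' => ?_⟩
    rw [ContinuousMap.mul_apply, ContinuousMap.mul_apply,
      hf y y' fun x hx => hyy' x (le_sup_left (a := E) hx),
      hg y y' fun x hx => hyy' x (le_sup_right (a := E) hx)]

theorem finiteLevelSubalgebra_separatesPoints [CharZero K] {X : Type*} [TopologicalSpace X]
    [Algebra.IsAlgebraic ℚ K] {absv : X → AbsoluteValue K ℝ}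
    (hsep : ∀ y y', (∀ x, absv y x = absv y' x) → y = y')
    (hcont : ∀ α : Kˣ, Continuous fun y => Real.log (absv y α)) :
    (finiteLevelSubalgebra absv).SeparatesPoints := by
  intro y y' hyy'
  obtain ⟨x, hx⟩ : ∃ x, absv y x ≠ absv y' x := by
    by_contra! hall
    exact hyy' (hsep y y' hall)
  have hx0 : x ≠ 0 := by
    rintro rfl
    simp at hx
  refine ⟨_, ⟨⟨_, hcont (Units.mk0 x hx0)⟩, ⟨IntermediateField.adjoin ℚ {x},
    IntermediateField.adjoin.finiteDimensional (Algebra.IsIntegral.isIntegral x),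
    fun z z' hzz' => ?_⟩, rfl⟩, fun heq => hx ?_⟩
  · exact congrArg Real.log (hzz' x (IntermediateField.mem_adjoin_simple_self ℚ x))
  · exact Real.log_injOn_pos ((absv y).pos hx0) ((absv y').pos hx0) heq

variable [IsAlgClosed K] {hb : ∀ α : Kˣ, ∃ M : ℝ, ∀ y, |Real.log (absv y α)| ≤ M}

theorem log_mem_logClosure {x : K} (hx : x ≠ 0) :
    (fun y => Real.log (absv y x)) ∈ logClosure absv hb :=
  fun ε hε => ⟨Units.mk0 x hx, fun y => by simpa using hε⟩

theorem mem_logClosure_of_forall_exists_near {g : Y → ℝ}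
    (h : ∀ ε : ℝ, 0 < ε → ∃ f ∈ logClosure absv hb, ∀ y, |g y - f y| ≤ ε) :
    g ∈ logClosure absv hb := by
  intro ε hε
  obtain ⟨f, hf, hfg⟩ := h (ε / 2) (by positivity)
  obtain ⟨α, hα⟩ := hf (ε / 2) (by positivity)
  refine ⟨α, fun y => ?_⟩
  have h1 := hα y
  have h2 := hfg y
  rw [abs_lt] at *
  rw [abs_le] at h2
  constructor <;> linarith

variable [CharZero K]

theorem arch_sub_padic_mem_logClosure (h : ExtendsRat absv ratPlace) (p : Nat.Primes) :
    (fun y => (if ratPlace y = none then (1 : ℝ) else 0) - if ratPlace y = some p then 1 else 0) ∈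
      logClosure absv hb := by
  have hp : Fact (p : ℕ).Prime := ⟨p.2⟩
  have hK : (((p : ℕ) : ℚ) : K) ≠ 0 := by
    exact_mod_cast p.2.ne_zero
  have hlog : Real.log (p : ℕ) ≠ 0 := by
    have : (1 : ℝ) < (p : ℕ) := by exact_mod_cast p.2.one_lt
    exact (Real.log_pos this).ne'
  convert (logClosure absv hb).smul_mem (Real.log (p : ℕ))⁻¹ (log_mem_logClosure hK) using 1
  ext y
  rw [Pi.smul_apply, smul_eq_mul]
  rcases hy : ratPlace y with _ | q
  · rw [h.arch y hy]
    simp [hlog]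
  · rw [h.padic y q hy]
    have hq : Fact (q : ℕ).Prime := ⟨q.2⟩
    by_cases hqp : q = p
    · subst hqp
      simp [hlog]
    · have : (q : ℕ) ≠ p := fun e => hqp (Subtype.ext e)
      have h2 := padicNorm.padicNorm_of_prime_of_ne (p := q) (q := p) this
      simp [hqp, h2]

theorem arch_mem_logClosure (h : ExtendsRat absv ratPlace) :
    (fun y => if ratPlace y = none then (1 : ℝ) else 0) ∈ logClosure absv hb := by
  refine mem_logClosure_of_forall_exists_near fun ε hε => ?_
  obtain ⟨n, hn⟩ := exists_nat_gt ε⁻¹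
  have hn0 : (0 : ℝ) < n := (inv_pos.2 hε).trans hn
  obtain ⟨s, hs⟩ := Infinite.exists_subset_card_eq Nat.Primes n
  refine ⟨_, (logClosure absv hb).smul_mem (n : ℝ)⁻¹ (Submodule.sum_mem _ fun p (_ : p ∈ s) =>
    arch_sub_padic_mem_logClosure h p), fun y => ?_⟩
  have hε' : (n : ℝ)⁻¹ ≤ ε := (inv_lt_of_inv_lt₀ hε hn).le
  rcases hy : ratPlace y with _ | q
  · simp [hy, hs, hn0.ne', hε.le]
  · by_cases hq : q ∈ s <;> simp [hy, hq, hε.le, hε']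

open NumberField.Units NumberField.Units.dirichletUnitTheorem in
/-- Functions on the archimedean places that only depend on the restriction to a number field
are in the closure, by Dirichlet's unit theorem. -/
theorem mem_logClosure_of_factors_infinitePlace (h : ExtendsRat absv ratPlace)
    {L : Type*} [Field L] [NumberField L] (i : L →+* K) (c : InfinitePlace L → ℝ) {g : Y → ℝ}
    (hg0 : ∀ y, ratPlace y ≠ none → g y = 0)
    (hg : ∀ y, ratPlace y = none → ∀ w : InfinitePlace L, (∀ x, w x = absv y (i x)) → g y = c w) :
    g ∈ logClosure absv hb := by
  classical
  have hw : ∀ y, ∃ w : InfinitePlace L, ratPlace y = none → ∀ x, w x = absv y (i x) := by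
    intro y
    by_cases hy : ratPlace y = none
    · obtain ⟨w, hw⟩ := exists_infinitePlace_of_forall_rat ((absv y).comp i.injective) fun q => by
        change absv y (i q) = _
        rw [map_ratCast]
        exact h.arch y hy q
      exact ⟨w, fun _ => hw⟩
    · exact ⟨w₀, fun h' => absurd h' hy⟩
  choose w hw using hw
  let Φ : logSpace L →ₗ[ℝ] (Y → ℝ) :=
    { toFun := fun l y => if ratPlace y = none then
        (if hne : w y ≠ w₀ then l ⟨w y, hne⟩ else -∑ v, l v) / (w y).mult else 0
      map_add' := fun l l' => by
        ext y
        simp only [Pi.add_apply, Finset.sum_add_distrib]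
        split_ifs <;> ring
      map_smul' := fun r l => by
        ext y
        simp only [Pi.smul_apply, smul_eq_mul, ← Finset.mul_sum, RingHom.id_apply]
        split_ifs <;> ring }
  have hmult : ∀ v : InfinitePlace L, (v.mult : ℝ) ≠ 0 := fun v => InfinitePlace.mult_coe_ne_zero
  have hΦ : ∀ l, Φ l ∈ logClosure absv hb := by
    suffices Submodule.span ℝ (unitLattice L : Set (logSpace L)) ≤ (logClosure absv hb).comap Φ by
      intro l
      rw [unitLattice_span_eq_top] at this
      exact this trivial
    rw [Submodule.span_le]
    rintro _ ⟨u, -, rfl⟩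
    obtain ⟨u, rfl⟩ := Additive.ofMul.surjective u
    have hu : i (u : 𝓞 L) ≠ 0 := by simp
    rw [SetLike.mem_coe, Submodule.mem_comap]
    convert log_mem_logClosure (absv := absv) (hb := hb) hu using 1
    ext y
    simp only [Φ, LinearMap.coe_mk, AddHom.coe_mk, AddMonoidHom.coe_toIntLinearMap,
      logEmbedding_component]
    rcases hy : ratPlace y with _ | p
    · rw [← hw y hy]
      by_cases hne : w y = w₀
      · have hs := sum_mult_mul_log u
        rw [Fintype.sum_eq_add_sum_subtype_ne _ w₀, ← eq_neg_iff_add_eq_zero] at hs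
        simp [hne, ← hs, hmult]
      · simp [hne, hmult]
    · simp [h.eq_one_of_isUnit hy i u.isUnit]
  let t : ℝ := (∑ v : InfinitePlace L, v.mult * c v) / ∑ v : InfinitePlace L, (v.mult : ℝ)
  have hsum : ∑ v : InfinitePlace L, (v.mult : ℝ) * (c v - t) = 0 := by
    have hpos : 0 < ∑ v : InfinitePlace L, (v.mult : ℝ) :=
      Finset.sum_pos (fun v _ => by exact_mod_cast InfinitePlace.mult_pos) ⟨w₀, Finset.mem_univ _⟩
    simp only [mul_sub, Finset.sum_sub_distrib, ← Finset.sum_mul, t]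
    field_simp
    ring
  rw [Fintype.sum_eq_add_sum_subtype_ne _ w₀] at hsum
  convert (logClosure absv hb).add_mem ((logClosure absv hb).smul_mem t (arch_mem_logClosure h))
    (hΦ fun v => v.1.mult * (c v - t)) using 1
  ext y
  simp only [Φ, LinearMap.coe_mk, AddHom.coe_mk, Pi.add_apply, Pi.smul_apply, smul_eq_mul]
  by_cases hy : ratPlace y = none
  · rw [hg y hy (w y) (hw y hy)]
    by_cases hne : w y = w₀
    · rw [← eq_neg_iff_add_eq_zero] at hsum
      simp [hy, hne, ← hsum, hmult]
    · simp [hy, hne, hmult]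
  · simp [hy, hg0 y hy]

/-- The functions supported on the archimedean places which only depend on the restriction to a
number field through the logarithm of one element are in the closure. -/
theorem arch_log_mem_logClosure (h : ExtendsRat absv ratPlace) {L : Type*} [Field L]
    [NumberField L] (i : L →+* K) (a : L) :
    (fun y => if ratPlace y = none then Real.log (absv y (i a)) else 0) ∈ logClosure absv hb :=
  mem_logClosure_of_factors_infinitePlace h i (fun w => Real.log (w a)) (fun y hy => by simp [hy])
    fun y hy w hw => by simp [hy, hw]

open Classical in
theorem indicator_isCenter_mem_logClosure (h : ExtendsRat absv ratPlace) {L : Type*} [Field L]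
    [NumberField L] (i : L →+* K) {P : Ideal (𝓞 L)} (hPp : P.IsPrime) :
    (fun y => if ratPlace y ≠ none ∧ IsCenter absv i y P then (1 : ℝ) else 0) ∈
      logClosure absv hb := by
  by_cases hex : ∃ y₀, ratPlace y₀ ≠ none ∧ IsCenter absv i y₀ P
  swap
  · push Not at hex
    convert (logClosure absv hb).zero_mem using 1
    ext y
    simpa using hex y
  obtain ⟨y₀, hy₀, hc₀⟩ := hex
  obtain ⟨p, hp⟩ := Option.ne_none_iff_exists'.1 hy₀
  have hPbot : P ≠ ⊥ := by
    rintro rfl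
    have : ((p : ℕ) : 𝓞 L) = 0 := hc₀.natCast_mem h hp
    exact p.2.ne_zero (by exact_mod_cast this)
  obtain ⟨n, hn, a, ha⟩ := exists_pow_eq_span_singleton_s2 hPbot
  have haP : a ∈ P := Ideal.pow_le_self hn (ha ▸ Ideal.mem_span_singleton_self a)
  have ha0 : a ≠ 0 := by
    rintro rfl
    exact pow_ne_zero n hPbot (by simpa using ha)
  have hia : i a ≠ 0 := by simpa using ha0
  have hκ : Real.log (absv y₀ (i a)) ≠ 0 :=
    (Real.log_neg ((absv y₀).pos hia) ((hc₀ a).1 haP)).ne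
  convert (logClosure absv hb).smul_mem (Real.log (absv y₀ (i a)))⁻¹
    ((logClosure absv hb).sub_mem (log_mem_logClosure hia) (arch_log_mem_logClosure h i a)) using 1
  ext y
  simp only [Pi.smul_apply, Pi.sub_apply, smul_eq_mul]
  rcases hy : ratPlace y with _ | q
  · simp
  by_cases hc : IsCenter absv i y P
  · simp [hc, IsCenter.absv_eq h hy hp hPp hc hc₀, hκ]
  · have haQ : absv y (i a) = 1 := by
      obtain ⟨Q, hQ, hcQ⟩ := exists_isCenter h hy i
      refine hcQ.eq_one h hy fun haQ => hc ?_
      have hPQ : P ≤ Q := hQ.le_of_pow_le (n := n) (ha ▸ (Ideal.span_singleton_le_iff_mem Q).2 haQ)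
      rwa [(hPp.isMaximal hPbot).eq_of_le hQ.ne_top hPQ]
    simp [hc, haQ]

/-- A function on a fiber over a place of `ℚ` which only depends on the restriction to a number
field is in the closure. -/
theorem mem_logClosure_of_factors (h : ExtendsRat absv ratPlace) (v : Option Nat.Primes)
    {L : Type*} [Field L] [NumberField L] (i : L →+* K) {g : Y → ℝ}
    (hg0 : ∀ y, ratPlace y ≠ v → g y = 0)
    (hg : ∀ y y', ratPlace y = v → ratPlace y' = v → (∀ x, absv y (i x) = absv y' (i x)) →
      g y = g y') :
    g ∈ logClosure absv hb := by
  classical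
  rcases v with _ | p
  · refine mem_logClosure_of_factors_infinitePlace h i (fun w =>
      if hw : ∃ y, ratPlace y = none ∧ ∀ x, w x = absv y (i x) then g hw.choose else 0) hg0
      fun y hy w hw => ?_
    have hex : ∃ y, ratPlace y = none ∧ ∀ x, w x = absv y (i x) := ⟨y, hy, hw⟩
    rw [dif_pos hex]
    exact hg _ _ hy hex.choose_spec.1 fun x => by rw [← hw, hex.choose_spec.2]
  · have hp0 : Ideal.span {((p : ℕ) : 𝓞 L)} ≠ 0 := by
      simpa using p.2.ne_zero
    have hfin := Ideal.finite_factors hp0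
    let c : Ideal (𝓞 L) → ℝ := fun P =>
      if hP : ∃ y, ratPlace y = some p ∧ IsCenter absv i y P then g hP.choose else 0
    convert Submodule.sum_mem (logClosure absv hb) fun P (_ : P ∈ hfin.toFinset) =>
      (logClosure absv hb).smul_mem (c P.asIdeal)
        (indicator_isCenter_mem_logClosure h i P.isPrime) using 1
    ext y
    simp only [Finset.sum_apply, Pi.smul_apply, smul_eq_mul]
    by_cases hy : ratPlace y = some p
    · obtain ⟨P, hP, hc⟩ := exists_isCenter h hy i
      have hpP := hc.natCast_mem h hy
      let P' : IsDedekindDomain.HeightOneSpectrum (𝓞 L) := ⟨P, hP, by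
        rintro rfl
        exact hp0 (by simpa using hpP)⟩
      have hex : ∃ y, ratPlace y = some p ∧ IsCenter absv i y P := ⟨y, hy, hc⟩
      rw [Finset.sum_eq_single P']
      · simp only [P', c, hex, hc, hy]
        simp only [ne_eq, reduceCtorEq, not_false_eq_true, and_self, if_true, mul_one, dif_pos]
        exact hg _ _ hy hex.choose_spec.1
          (IsCenter.absv_eq h hy hex.choose_spec.1 hP hc hex.choose_spec.2)
      · intro Q _ hQ
        have : ¬ IsCenter absv i y Q.asIdeal := fun hcQ => hQ <| by
          ext x
          exact (hcQ x).trans (hc x).symm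
        simp [this]
      · intro hmem
        refine absurd ?_ hmem
        simpa [Ideal.dvd_span_singleton] using hpP
    · rw [hg0 y hy]
      refine (Finset.sum_eq_zero fun P _ => ?_).symm
      by_cases hcy : ratPlace y ≠ none ∧ IsCenter absv i y P.asIdeal
      · obtain ⟨q, hq⟩ := Option.ne_none_iff_exists'.1 hcy.1
        have : ¬ ∃ y, ratPlace y = some p ∧ IsCenter absv i y P.asIdeal := by
          rintro ⟨y', hy', hc'⟩
          exact hy (hq.trans (congrArg some (hcy.2.prime_eq h hq hy' P.isPrime hc')))
        simp [c, this]
      · simp [hcy]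

theorem mem_logClosure_of_factors_intermediateField (h : ExtendsRat absv ratPlace)
    (v : Option Nat.Primes) (E : IntermediateField ℚ K) [FiniteDimensional ℚ E] {g : Y → ℝ}
    (hg0 : ∀ y, ratPlace y ≠ v → g y = 0)
    (hg : ∀ y y', ratPlace y = v → ratPlace y' = v → (∀ x ∈ E, absv y x = absv y' x) →
      g y = g y') : g ∈ logClosure absv hb := by
  have : NumberField E :=
    { to_charZero := inferInstance
      to_finiteDimensional := by convert ‹FiniteDimensional ℚ E› }
  exact mem_logClosure_of_factors h v (algebraMap E K) hg0 fun y y' hy hy' hyy' =>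
    hg y y' hy hy' fun x hx => hyy' ⟨x, hx⟩

open Classical in
theorem indicator_fiber_mem_logClosure [TopologicalSpace Y] [Algebra.IsAlgebraic ℚ K]
    (h : ExtendsRat absv ratPlace) (hsep : ∀ y y', (∀ x, absv y x = absv y' x) → y = y')
    (hcont : ∀ α : Kˣ, Continuous fun y => Real.log (absv y α)) {v : Option Nat.Primes}
    (hv : IsCompact {y | ratPlace y = v}) {F : Y → ℝ} (hF : Continuous F) :
    (fun y => if ratPlace y = v then F y else 0) ∈ logClosure absv hb := by
  refine mem_logClosure_of_forall_exists_near fun ε hε => ?_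
  let X := {y | ratPlace y = v}
  have : CompactSpace X := isCompact_iff_compactSpace.1 hv
  obtain ⟨⟨g, E, hE, hgE⟩, hg⟩ :=
    ContinuousMap.exists_mem_subalgebra_near_continuous_of_separatesPoints
      (finiteLevelSubalgebra fun y : X => absv y)
      (finiteLevelSubalgebra_separatesPoints
        (fun y y' hyy' => Subtype.ext (hsep y y' hyy'))
        (fun α => (hcont α).comp continuous_subtype_val))
      (fun y : X => F y) (hF.comp continuous_subtype_val) ε hε
  refine ⟨fun y => if hy : ratPlace y = v then g ⟨y, hy⟩ else 0,
    mem_logClosure_of_factors_intermediateField h v E (fun y hy => dif_neg hy)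
      fun y y' hy hy' hyy' => ?_, fun y => ?_⟩
  · rw [dif_pos hy, dif_pos hy']
    exact hgE _ _ hyy'
  · by_cases hy : ratPlace y = v
    · simpa [hy, abs_sub_comm] using (hg ⟨y, hy⟩).le
    · simpa [hy] using hε.le

/-- The uniform closure of the functions `y ↦ log ‖α‖_y` contains all continuous functions which
vanish at infinity. -/
theorem zeroAtInfty_mem_logClosure [TopologicalSpace Y] [Algebra.IsAlgebraic ℚ K]
    (h : ExtendsRat absv ratPlace) (hsep : ∀ y y', (∀ x, absv y x = absv y' x) → y = y')
    (hcont : ∀ α : Kˣ, Continuous fun y => Real.log (absv y α))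
    (hcompact : ∀ v, IsCompact {y | ratPlace y = v}) (hopen : ∀ v, IsOpen {y | ratPlace y = v})
    (F : ZeroAtInftyContinuousMap Y ℝ) : ⇑F ∈ logClosure absv hb := by
  classical
  refine mem_logClosure_of_forall_exists_near fun ε hε => ?_
  obtain ⟨C, hC, hFC⟩ := Filter.mem_cocompact.1
    (F.zero_at_infty'.eventually (Metric.closedBall_mem_nhds 0 hε))
  obtain ⟨T, hT⟩ := hC.elim_finite_subcover _ hopen fun y _ => Set.mem_iUnion.2 ⟨ratPlace y, rfl⟩
  refine ⟨∑ v ∈ T, fun y => if ratPlace y = v then F y else 0, Submodule.sum_mem _ fun v _ =>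
    indicator_fiber_mem_logClosure h hsep hcont (hcompact v) F.continuous, fun y => ?_⟩
  rw [Finset.sum_apply, Finset.sum_ite_eq]
  split_ifs with hy
  · simpa using hε.le
  · have hyC : y ∈ Cᶜ := fun hyC => hy (by simpa using hT hyC)
    simpa using hFC hyC

end LogClosure

/-- Let `Y` be the space of all places of the algebraic closure `Q̄` of
`ℚ` with its natural totally disconnected, locally compact, Hausdorff topology
(a point `y` of `Y` is described by the absolute value `‖·‖_y = absv y` in the place `y`
normalized so that its restriction to `ℚ` is the usual archimedean absolute value or a
`p`-adic absolute value, according to the place `ratPlace y` of `ℚ` that `y` lies over;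
distinct points of `Y` are distinct places, every absolute value of `Q̄` extending a
standard absolute value of `ℚ` occurs, each fiber `Y(ℚ,v)` over a place `v` of `ℚ` is
compact and open, and each
function `f_α(y) = log ‖α‖_y` for `α ∈ Q̄ˣ` is continuous with compact support).
Then the set `𝔉 = {f_α : α ∈ Q̄ˣ}` is dense in `C₀(Y)`, the Banach space of continuous
real-valued functions on `Y` vanishing at infinity, equipped with the supremum norm. -/
theorem weilHeight_image_dense_in_C0
    (Y : Type*) [TopologicalSpace Y] [LocallyCompactSpace Y] [T2Space Y]
    [TotallyDisconnectedSpace Y]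
    (absv : Y → AbsoluteValue (AlgebraicClosure ℚ) ℝ)
    (ratPlace : Y → Option Nat.Primes)
    (hArch : ∀ y, ratPlace y = none →
      ∀ q : ℚ, absv y (algebraMap ℚ (AlgebraicClosure ℚ) q) = |(q : ℝ)|)
    (hPadic : ∀ y (p : Nat.Primes), ratPlace y = some p →
      ∀ q : ℚ, absv y (algebraMap ℚ (AlgebraicClosure ℚ) q) = (padicNorm p q : ℝ))
    (hSep : ∀ y y', (∀ x, absv y x = absv y' x) → y = y')
    (hAllArch : ∀ w : AbsoluteValue (AlgebraicClosure ℚ) ℝ,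
      (∀ q : ℚ, w (algebraMap ℚ (AlgebraicClosure ℚ) q) = |(q : ℝ)|) →
      ∃ y, ∀ x, absv y x = w x)
    (hAllPadic : ∀ (p : Nat.Primes) (w : AbsoluteValue (AlgebraicClosure ℚ) ℝ),
      (∀ q : ℚ, w (algebraMap ℚ (AlgebraicClosure ℚ) q) = (padicNorm p q : ℝ)) →
      ∃ y, ∀ x, absv y x = w x)
    (hFiberCompact : ∀ v : Option Nat.Primes, IsCompact {y | ratPlace y = v})
    (hFiberOpen : ∀ v : Option Nat.Primes, IsOpen {y | ratPlace y = v})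
    (hCont : ∀ α : (AlgebraicClosure ℚ)ˣ,
      Continuous fun y : Y => Real.log (absv y (α : AlgebraicClosure ℚ)))
    (hSupp : ∀ α : (AlgebraicClosure ℚ)ˣ,
      HasCompactSupport fun y : Y => Real.log (absv y (α : AlgebraicClosure ℚ)))
    :
    ∀ F : ZeroAtInftyContinuousMap Y ℝ, ∀ ε : ℝ, 0 < ε →
      ∃ α : (AlgebraicClosure ℚ)ˣ,
        ∀ y : Y, |F y - Real.log (absv y (α : AlgebraicClosure ℚ))| < ε := by
  have hb : ∀ α : (AlgebraicClosure ℚ)ˣ, ∃ M : ℝ, ∀ y,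
      |Real.log (absv y (α : AlgebraicClosure ℚ))| ≤ M :=
    fun α => (hSupp α).exists_bound_of_continuous (hCont α)
  have h : ExtendsRat absv ratPlace :=
    { arch := fun y hy q => by simpa using hArch y hy q
      padic := fun y p hy q => by simpa using hPadic y p hy q }
  have halg : @Algebra.IsAlgebraic ℚ (AlgebraicClosure ℚ) _ _ DivisionRing.toRatAlgebra := by
    rw [Subsingleton.elim DivisionRing.toRatAlgebra (AlgebraicClosure.instAlgebra ℚ)]
    exact AlgebraicClosure.isAlgebraic ℚ
  exact zeroAtInfty_mem_logClosure (hb := hb) h hSep hCont hFiberCompact hFiberOpen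
end
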